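/- arXiv:0709.0243 — 4 statements merged into one kernel-verified Lean document; each statement's English description precedes it below -/
import Mathlib

section
/- Let 1 < p < ∞, δ > 1, q > q*(p,δ), and I = [0,1]. Let s⁺ ∈ [0, 1/p] be the unique solution of (1 − p s)^{p−1}/(1 − (p−1) s)^p = δ^{−p}, set γ = p + q' − 1, and for a point (x₁, x₂) with x₁ > 0 and x₁^p ≤ x₂ ≤ (δ x₁)^p let r⁺ ∈ [0, 1/p] be the unique solution of (1 − p r)^{p−1}/(1 − (p−1) r)^p = x₂/(δ x₁)^p. Then the Bellman function satisfies the exact formula: sup{ ⟨w^{1−q'}⟩_I : w ∈ RH_p^δ(I), ⟨w⟩_I = x₁, ⟨w^p⟩_I = x₂ } = x₁^{1−q'} · ((1 − p s⁺)/(1 − p r⁺))^{q'} · ((1 − (p−1) r⁺)/(1 − (p−1) s⁺))^{q'−1} · (1 − γ r⁺)/(1 − γ s⁺). -/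
open MeasureTheory Set ENNReal

/-- The average `⟨f⟩_{(a,b)}` of an `ℝ≥0∞`-valued function over an interval. -/
noncomputable def avgE (f : ℝ → ℝ≥0∞) (a b : ℝ) : ℝ≥0∞ :=
  (∫⁻ t in Set.Ioo a b, f t) / ENNReal.ofReal (b - a)

/-- `w ∈ RH_p^δ([A,B])`. -/
def MemRH (p δ A B : ℝ) (w : ℝ → ℝ≥0∞) : Prop :=
  Measurable w ∧ (∫⁻ t in Set.Ioo A B, w t) ≠ ⊤ ∧
    ∀ a b, A ≤ a → a < b → b ≤ B →
      avgE (fun t => w t ^ p) a b ≤ ENNReal.ofReal δ ^ p * (avgE w a b) ^ p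

/-- A function whose integral over every connected component of a bounded open set is nonpositive
has nonpositive integral over the whole set. -/
theorem setIntegral_nonpos_of_components {U : Set ℝ} {g : ℝ → ℝ} {A B : ℝ} (hU : IsOpen U)
    (hUb : U ⊆ Ioo A B) (hg : Integrable g)
    (h : ∀ a b, a < b → Ioo a b ⊆ U → a ∉ U → b ∉ U → ∫ t in Ioo a b, g t ≤ 0) :
    ∫ t in U, g t ≤ 0 := by
  have hcomp : ∀ x ∈ U, ∃ a b, a < b ∧ connectedComponentIn U x = Ioo a b ∧ a ∉ U ∧ b ∉ U := by
    intro x hx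
    set C := connectedComponentIn U x with hC
    have hCU : C ⊆ U := connectedComponentIn_subset U x
    have hxC : x ∈ C := mem_connectedComponentIn hx
    have hCo : IsOpen C := hU.connectedComponentIn
    have hCc : IsPreconnected C := isPreconnected_connectedComponentIn
    have hbb : BddBelow C := ⟨A, fun y hy => (hUb (hCU hy)).1.le⟩
    have hba : BddAbove C := ⟨B, fun y hy => (hUb (hCU hy)).2.le⟩
    have hlt : sInf C < sSup C := by
      obtain ⟨ε, hε, hball⟩ := Metric.isOpen_iff.1 hCo x hxC
      have h1 : x + ε / 2 ∈ C := hball (by simp [abs_of_pos hε, hε])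
      have := csInf_le hbb hxC
      have := le_csSup hba h1
      linarith
    have hsub : Ioo (sInf C) (sSup C) ⊆ C := IsConnected.Ioo_csInf_csSup_subset ⟨⟨x, hxC⟩, hCc⟩ hbb hba
    have haC : sInf C ∉ C := fun hm => by
      obtain ⟨ε, hε, hball⟩ := Metric.isOpen_iff.1 hCo _ hm
      have h1 : sInf C - ε / 2 ∈ C := hball (by simp [abs_of_pos hε, hε])
      have := csInf_le hbb h1
      linarith
    have hbC : sSup C ∉ C := fun hm => by
      obtain ⟨ε, hε, hball⟩ := Metric.isOpen_iff.1 hCo _ hm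
      have h1 : sSup C + ε / 2 ∈ C := hball (by simp [abs_of_pos hε, hε])
      have := le_csSup hba h1
      linarith
    have hCeq : C = Ioo (sInf C) (sSup C) := by
      refine subset_antisymm (fun y hy => ⟨?_, ?_⟩) hsub
      · exact lt_of_le_of_ne (csInf_le hbb hy) fun e => haC (e ▸ hy)
      · exact lt_of_le_of_ne (le_csSup hba hy) fun e => hbC (e ▸ hy)
    have hxI : x ∈ Ioo (sInf C) (sSup C) := hCeq ▸ hxC
    refine ⟨sInf C, sSup C, hlt, hCeq, fun ha => haC ?_, fun hb => hbC ?_⟩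
    · have : Ico (sInf C) (sSup C) ⊆ C := by
        refine isPreconnected_Ico.subset_connectedComponentIn (Ioo_subset_Ico_self hxI) ?_
        intro y hy
        rcases eq_or_lt_of_le hy.1 with e | e
        · exact e ▸ ha
        · exact hCU (hsub ⟨e, hy.2⟩)
      exact this ⟨le_rfl, hlt⟩
    · have : Ioc (sInf C) (sSup C) ⊆ C := by
        refine isPreconnected_Ioc.subset_connectedComponentIn (Ioo_subset_Ioc_self hxI) ?_
        intro y hy
        rcases eq_or_lt_of_le hy.2 with e | e
        · exact e ▸ hb
        · exact hCU (hsub ⟨hy.1, e⟩)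
      exact this ⟨hlt, le_rfl⟩
  set K : Set (Set ℝ) := connectedComponentIn U '' U with hK
  have hKd : K.PairwiseDisjoint id := by
    rintro _ ⟨x, hx, rfl⟩ _ ⟨y, hy, rfl⟩ hne
    rw [Function.onFun, id, id, Set.disjoint_left]
    intro z hz1 hz2
    exact hne ((connectedComponentIn_eq hz1).trans (connectedComponentIn_eq hz2).symm)
  have hKc : K.Countable := by
    refine hKd.countable_of_isOpen ?_ ?_
    · rintro _ ⟨x, hx, rfl⟩
      exact hU.connectedComponentIn
    · rintro _ ⟨x, hx, rfl⟩
      exact ⟨x, mem_connectedComponentIn hx⟩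
  have hUK : U = ⋃ s : K, (s : Set ℝ) := by
    ext x
    simp only [mem_iUnion, Subtype.exists, exists_prop]
    constructor
    · exact fun hx => ⟨_, ⟨x, hx, rfl⟩, mem_connectedComponentIn hx⟩
    · rintro ⟨_, ⟨y, hy, rfl⟩, hx⟩
      exact connectedComponentIn_subset U y hx
  have : Countable K := hKc
  rw [hUK, integral_iUnion]
  · refine tsum_nonpos ?_
    rintro ⟨_, x, hx, rfl⟩
    obtain ⟨a, b, hab, he, ha, hb⟩ := hcomp x hx
    have hs : Ioo a b ⊆ U := he ▸ connectedComponentIn_subset U x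
    simpa [he] using h a b hab hs ha hb
  · rintro ⟨_, x, hx, rfl⟩
    exact hU.connectedComponentIn.measurableSet
  · intro s t hst
    exact hKd s.2 t.2 fun e => hst (Subtype.ext e)
  · exact hg.integrableOn

/-- A form of the rising sun lemma: if `F` does not decrease from `0` to `1`, there is an open set
whose components join points of equal value of `F` and outside which `F` attains its running
maximum. -/
theorem exists_risingSun {F g : ℝ → ℝ} (hF : Continuous F) (hF01 : F 0 ≤ F 1) (hg : Integrable g)
    (h : ∀ a b, 0 ≤ a → a < b → b ≤ 1 → F a = F b → ∫ t in Ioo a b, g t ≤ 0) :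
    ∃ U : Set ℝ, IsOpen U ∧ U ⊆ Ioo 0 1 ∧ ∫ t in U, g t ≤ 0 ∧
      ∀ x ∈ Ioo (0 : ℝ) 1, x ∉ U → ∀ y, 0 ≤ y → y < x → F y ≤ F x := by
  set U : Set ℝ := {x | x ∈ Ioo (0 : ℝ) 1 ∧ ∃ y, 0 ≤ y ∧ y < x ∧ (F x < F y ∨ F 1 ≤ F y)} with hUdef
  have hUo : IsOpen U := by
    have : U = Ioo 0 1 ∩ ⋃ y : ℝ, {x | 0 ≤ y ∧ y < x ∧ (F x < F y ∨ F 1 ≤ F y)} := by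
      ext x; simp [hUdef]
    rw [this]
    refine isOpen_Ioo.inter (isOpen_iUnion fun y => ?_)
    refine isOpen_const.inter ((isOpen_lt continuous_const continuous_id).inter ?_)
    exact (isOpen_lt hF continuous_const).union isOpen_const
  have hU01 : U ⊆ Ioo 0 1 := fun x hx => hx.1
  refine ⟨U, hUo, hU01, ?_, ?_⟩
  · refine setIntegral_nonpos_of_components hUo hU01 hg ?_
    intro a b hab hsub ha hb
    have hcl : Icc a b ⊆ Icc 0 1 := by
      rw [← closure_Ioo hab.ne, ← closure_Ioo (zero_ne_one' ℝ)]
      exact closure_mono (hsub.trans hU01)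
    have ha0 : 0 ≤ a := (hcl (left_mem_Icc.2 hab.le)).1
    have hb1 : b ≤ 1 := (hcl (right_mem_Icc.2 hab.le)).2
    have hpast : ∀ y, 0 ≤ y → y < a → F y ≤ F a ∧ F y < F 1 := by
      intro y hy0 hya
      by_contra hcon
      refine ha ⟨⟨by linarith, by linarith⟩, y, hy0, hya, ?_⟩
      by_contra hcon2
      push Not at hcon2
      exact hcon hcon2
    have hpastb : b < 1 → ∀ y, 0 ≤ y → y < b → F y ≤ F b ∧ F y < F 1 := by
      intro hb1 y hy0 hya
      by_contra hcon
      refine hb ⟨⟨by linarith, by linarith⟩, y, hy0, hya, ?_⟩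
      by_contra hcon2
      push Not at hcon2
      exact hcon hcon2
    refine h a b ha0 hab hb1 (le_antisymm ?_ ?_)
    · rcases lt_or_eq_of_le hb1 with hb1 | rfl
      · exact (hpastb hb1 a ha0 hab).1
      · rcases eq_or_lt_of_le ha0 with rfl | ha0
        · exact hF01
        · refine le_of_tendsto (hF.continuousWithinAt (s := Iio a) (x := a)) ?_
          filter_upwards [Ioo_mem_nhdsLT ha0] with y hy
          exact (hpast y hy.1.le hy.2).2.le
    · by_contra! hlt
      set l := (F a + F b) / 2 with hl
      set Z := Icc a b ∩ {x | l ≤ F x} with hZ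
      have hZc : IsCompact Z := isCompact_Icc.inter_right (isClosed_le continuous_const hF)
      have hZn : Z.Nonempty := ⟨b, right_mem_Icc.2 hab.le, by
        show l ≤ F b
        linarith⟩
      obtain ⟨z, ⟨hz, hzl⟩, hzmin⟩ := hZc.exists_isLeast hZn
      have hzl : l ≤ F z := hzl
      have hFz : F z = l := by
        refine le_antisymm ?_ hzl
        by_contra! hgt
        obtain ⟨y, hy, hyl⟩ := intermediate_value_Icc hz.1 hF.continuousOn
          (show l ∈ Icc (F a) (F z) from ⟨by linarith, hgt.le⟩)
        have := hzmin ⟨⟨hy.1, hy.2.trans hz.2⟩, hyl.ge⟩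
        have : y = z := le_antisymm hy.2 this
        rw [this] at hyl; linarith
      have hza : a < z := lt_of_le_of_ne hz.1 fun e => by rw [← e] at hFz; linarith
      have hzb : z < b := lt_of_le_of_ne hz.2 fun e => by rw [e] at hFz; linarith
      obtain ⟨-, y, hy0, hyz, hy⟩ := hsub ⟨hza, hzb⟩
      have hy' : l ≤ F y := by
        rcases hy with hy | hy
        · linarith
        · rcases lt_or_eq_of_le hb1 with hb1 | rfl
          · linarith [(hpastb hb1 y hy0 (hyz.trans hzb)).2]
          · linarith
      rcases lt_or_ge y a with hya | hya
      · linarith [(hpast y hy0 hya).1]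
      · exact absurd (hzmin ⟨⟨hya, hyz.le.trans hz.2⟩, hy'⟩) (not_le.2 hyz)
  · intro x hx hxU y hy0 hyx
    by_contra! hlt
    exact hxU ⟨hx, y, hy0, hyx, Or.inl hlt⟩

/-- The tangent-line deficit `y ^ p - (p (1 + ν) y - (p - 1)) / (1 + p ν)`. -/
noncomputable def tangentDeficit (p ν y : ℝ) : ℝ :=
  y ^ p - (p * (1 + ν) * y - (p - 1)) / (1 + p * ν)

/-- The solution `Q` of `α Q + y Q' = tangentDeficit p ν y` that is regular at `0`. -/
noncomputable def deficitPrimitive (p ν α y : ℝ) : ℝ :=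
  y ^ p / (p + α) - p * (1 + ν) * y / ((1 + p * ν) * (1 + α)) + (p - 1) / (α * (1 + p * ν))

theorem tangentDeficit_nonneg {p ν y : ℝ} (hp : 1 < p) (hν : 0 < ν) (hy : 1 ≤ y) :
    0 ≤ tangentDeficit p ν y := by
  have h1 := one_add_mul_self_le_rpow_one_add (s := y - 1) (by linarith) hp.le
  rw [add_sub_cancel] at h1
  have h2 : (p * (1 + ν) * y - (p - 1)) / (1 + p * ν) ≤ 1 + p * (y - 1) := by
    rw [div_le_iff₀ (by positivity)]
    have : 0 ≤ p * ν * (y - 1) * (p - 1) := by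
      have := sub_nonneg.2 hy
      have := sub_nonneg.2 hp.le
      positivity
    nlinarith
  unfold tangentDeficit
  linarith

theorem tangentDeficit_nonpos {p ν y : ℝ} (hp : 1 < p) (hν : 0 < ν) (hy1 : 1 / (1 + ν) ≤ y)
    (hy : y ≤ 1) : tangentDeficit p ν y ≤ 0 := by
  have hB := one_add_mul_self_le_rpow_one_add (s := ν) (by linarith) hp.le
  have hκ : 0 < 1 + ν := by linarith
  have hq : 0 < 1 + p * ν := by positivity
  have hend : (1 / (1 + ν)) ^ p ≤ 1 / (1 + p * ν) := by
    rw [Real.div_rpow zero_le_one hκ.le, Real.one_rpow]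
    exact one_div_le_one_div_of_le hq hB
  have hc := (convexOn_rpow hp.le).2
    (show 1 / (1 + ν) ∈ Ici (0 : ℝ) from one_div_nonneg.2 hκ.le)
    (show (1 : ℝ) ∈ Ici (0 : ℝ) from mem_Ici.2 zero_le_one)
    (show 0 ≤ (1 - y) * (1 + ν) / ν from div_nonneg (mul_nonneg (by linarith) hκ.le) hν.le)
    (show 0 ≤ ((1 + ν) * y - 1) / ν from
      div_nonneg (by rw [div_le_iff₀ hκ] at hy1; linarith) hν.le)
    (by field_simp; ring)
  simp only [smul_eq_mul, Real.one_rpow, mul_one] at hc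
  have e : (1 - y) * (1 + ν) / ν * (1 / (1 + ν)) + ((1 + ν) * y - 1) / ν = y := by
    field_simp; ring
  rw [e] at hc
  have h3 : (1 - y) * (1 + ν) / ν * (1 / (1 + ν)) ^ p ≤
      (1 - y) * (1 + ν) / ν * (1 / (1 + p * ν)) :=
    mul_le_mul_of_nonneg_left hend (div_nonneg (mul_nonneg (by linarith) hκ.le) hν.le)
  have h4 : (1 - y) * (1 + ν) / ν * (1 / (1 + p * ν)) + ((1 + ν) * y - 1) / ν =
      (p * (1 + ν) * y - (p - 1)) / (1 + p * ν) := by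
    field_simp; ring
  unfold tangentDeficit
  linarith

theorem deficitPrimitive_one {p ν α : ℝ} (hp : 1 < p) (hν : 0 < ν) (hα : 0 < α) :
    deficitPrimitive p ν α 1 =
      p * (p - 1) * (1 - α * ν) / (α * (1 + α) * (p + α) * (1 + p * ν)) := by
  have : 0 < 1 + p * ν := by positivity
  unfold deficitPrimitive
  rw [Real.one_rpow]
  field_simp
  ring

theorem deficitPrimitive_one_le {p ν α y : ℝ} (hp : 1 < p) (hν : 0 < ν) (hα : 0 < α)
    (hαν : α * ν < 1) (hy0 : 0 ≤ y) (hy : y ≤ 1) :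
    deficitPrimitive p ν α 1 ≤ deficitPrimitive p ν α y := by
  have h1 := one_add_mul_self_le_rpow_one_add (s := y - 1) (by linarith) hp.le
  rw [add_sub_cancel] at h1
  have hq : 0 < 1 + p * ν := by positivity
  have hpa : 0 < p + α := by positivity
  have h2 : (1 + p * (y - 1)) / (p + α) ≤ y ^ p / (p + α) := by gcongr
  have h3 : p / (p + α) ≤ p * (1 + ν) / ((1 + p * ν) * (1 + α)) := by
    rw [div_le_div_iff₀ hpa (by positivity)]
    have : 0 ≤ (p - 1) * (1 - α * ν) := mul_nonneg (by linarith) (by linarith)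
    nlinarith
  have h4 := mul_le_mul_of_nonneg_left h3 (sub_nonneg.2 hy)
  unfold deficitPrimitive
  rw [Real.one_rpow]
  have e1 : (1 + p * (y - 1)) / (p + α) = 1 / (p + α) - (1 - y) * (p / (p + α)) := by
    field_simp; ring
  have e2 : p * (1 + ν) * 1 / ((1 + p * ν) * (1 + α)) - p * (1 + ν) * y / ((1 + p * ν) * (1 + α))
      = (1 - y) * (p * (1 + ν) / ((1 + p * ν) * (1 + α))) := by
    field_simp
  linarith

theorem hasDerivAt_deficitPrimitive {p ν α x B : ℝ} (hp : 1 < p) (hν : 0 < ν) (hα : 0 < α)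
    (hx : 0 ≤ x) (hB : 0 < B) :
    HasDerivAt (fun B => B ^ (-α) * deficitPrimitive p ν α (x / B))
      (-(B ^ (-α - 1) * tangentDeficit p ν (x / B))) B := by
  have hq : 0 < 1 + p * ν := by positivity
  have hpa : 0 < p + α := by positivity
  have key : ∀ B : ℝ, 0 < B → B ^ (-α) * deficitPrimitive p ν α (x / B) =
      x ^ p / (p + α) * B ^ (-α - p) - p * (1 + ν) * x / ((1 + p * ν) * (1 + α)) * B ^ (-α - 1)
        + (p - 1) / (α * (1 + p * ν)) * B ^ (-α) := by
    intro B hB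
    unfold deficitPrimitive
    rw [Real.div_rpow hx hB.le, Real.rpow_sub hB, Real.rpow_sub hB, Real.rpow_one]
    have := Real.rpow_pos_of_pos hB p
    field_simp
  have hd : HasDerivAt (fun B : ℝ => x ^ p / (p + α) * B ^ (-α - p)
      - p * (1 + ν) * x / ((1 + p * ν) * (1 + α)) * B ^ (-α - 1)
        + (p - 1) / (α * (1 + p * ν)) * B ^ (-α))
      (x ^ p / (p + α) * ((-α - p) * B ^ (-α - p - 1))
      - p * (1 + ν) * x / ((1 + p * ν) * (1 + α)) * ((-α - 1) * B ^ (-α - 1 - 1))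
        + (p - 1) / (α * (1 + p * ν)) * (-α * B ^ (-α - 1))) B :=
    (((Real.hasDerivAt_rpow_const (Or.inl hB.ne')).const_mul _).sub
      ((Real.hasDerivAt_rpow_const (Or.inl hB.ne')).const_mul _)).add
      ((Real.hasDerivAt_rpow_const (Or.inl hB.ne')).const_mul _)
  convert! hd.congr_of_eventuallyEq ?_ using 1
  · unfold tangentDeficit
    have e1 : B ^ (-α - 1) = B ^ (-α) / B := by rw [Real.rpow_sub hB, Real.rpow_one]
    have e2 : B ^ (-α - 1 - 1) = B ^ (-α) / B / B := by rw [Real.rpow_sub hB, e1, Real.rpow_one]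
    have e3 : B ^ (-α - p - 1) = B ^ (-α) / B ^ p / B := by
      rw [Real.rpow_sub hB, Real.rpow_sub hB, Real.rpow_one]
    rw [Real.div_rpow hx hB.le, e1, e2, e3]
    have := Real.rpow_pos_of_pos hB p
    field_simp
    ring
  · filter_upwards [lt_mem_nhds hB] with b hb using key b hb

theorem continuous_tangentDeficit {p ν : ℝ} (hp : 1 < p) : Continuous (tangentDeficit p ν) := by
  unfold tangentDeficit
  have := Real.continuous_rpow_const (zero_le_one.trans hp.le)
  fun_prop

theorem integral_tangentDeficit {p ν α x a b : ℝ} (hp : 1 < p) (hν : 0 < ν) (hα : 0 < α)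
    (hx : 0 ≤ x) (ha : 0 < a) (hab : a ≤ b) :
    ∫ B in a..b, B ^ (-α - 1) * tangentDeficit p ν (x / B) =
      a ^ (-α) * deficitPrimitive p ν α (x / a) - b ^ (-α) * deficitPrimitive p ν α (x / b) := by
  have hpos : ∀ B ∈ uIcc a b, 0 < B := fun B hB => by
    rw [uIcc_of_le hab] at hB
    exact ha.trans_le hB.1
  have h := intervalIntegral.integral_eq_sub_of_hasDerivAt
    (fun B hB => hasDerivAt_deficitPrimitive hp hν hα hx (hpos B hB))
    (ContinuousOn.intervalIntegrable (by
      refine ContinuousOn.neg (ContinuousOn.mul ?_ ?_)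
      · exact fun B hB => (Real.continuousAt_rpow_const _ _
          (Or.inl (hpos B hB).ne')).continuousWithinAt
      · exact (continuous_tangentDeficit hp).comp_continuousOn
          (continuousOn_const.div continuousOn_id fun B hB => (hpos B hB).ne')))
  rw [intervalIntegral.integral_neg] at h
  linarith

/-- Lower bound for the integral over levels of the localised tangent deficit. -/
theorem le_integral_level_tangentDeficit {p ν α x ε c : ℝ} (hp : 1 < p) (hν : 0 < ν) (hα : 0 < α)
    (hαν : α * ν < 1) (hx : 0 ≤ x) (hε : 0 < ε) (hεc : ε < c) :
    deficitPrimitive p ν α 1 * (max x ε) ^ (-α) - c ^ (-α) * deficitPrimitive p ν α (x / c) ≤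
      ∫ B in ε..c, B ^ (-α - 1) * (if x < B then tangentDeficit p ν (x / B) else 0) := by
  have hc : 0 < c := hε.trans hεc
  rcases le_or_gt x c with hxc | hxc
  · set m := max x ε with hm
    have hm0 : 0 < m := lt_max_of_lt_right hε
    have hmc : m ≤ c := max_le hxc hεc.le
    have h1 : ∫ B in ε..c, B ^ (-α - 1) * (if x < B then tangentDeficit p ν (x / B) else 0) =
        ∫ B in m..c, B ^ (-α - 1) * tangentDeficit p ν (x / B) := by
      rw [intervalIntegral.integral_of_le hεc.le, intervalIntegral.integral_of_le hmc]
      have : Ioc m c = Ioc ε c ∩ Ioi x := by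
        ext B; simp only [mem_Ioc, mem_inter_iff, mem_Ioi, hm, max_lt_iff]; tauto
      rw [this, ← setIntegral_indicator measurableSet_Ioi]
      congr 1
      ext B
      by_cases h : x < B <;> simp [h]
    rw [h1, integral_tangentDeficit hp hν hα hx hm0 hmc]
    have := deficitPrimitive_one_le hp hν hα hαν (div_nonneg hx hm0.le)
      (div_le_one_of_le₀ (le_max_left x ε) hm0.le)
    have h2 := mul_le_mul_of_nonneg_left this (Real.rpow_nonneg hm0.le (-α))
    linarith
  · have h1 : ∫ B in ε..c, B ^ (-α - 1) * (if x < B then tangentDeficit p ν (x / B) else 0) =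
        ∫ B in ε..c, (0 : ℝ) := by
      refine intervalIntegral.integral_congr fun B hB => ?_
      rw [uIcc_of_le hεc.le] at hB
      simp [not_lt.2 (hB.2.trans hxc.le)]
    rw [h1, intervalIntegral.integral_zero, max_eq_left (hεc.trans hxc).le]
    have h2 := integral_tangentDeficit hp hν hα hx hc hxc.le
    have h3 : 0 ≤ ∫ B in c..x, B ^ (-α - 1) * tangentDeficit p ν (x / B) := by
      refine intervalIntegral.integral_nonneg hxc.le fun B hB => ?_
      have hB0 : 0 < B := hc.trans_le hB.1
      exact mul_nonneg (Real.rpow_nonneg hB0.le _)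
        (tangentDeficit_nonneg hp hν ((one_le_div hB0).2 hB.2))
    rw [div_self (hc.trans hxc).ne'] at h2
    linarith

theorem integrable_tangentDeficit_comp_div {μ : Measure ℝ} [IsFiniteMeasure μ] {W : ℝ → ℝ}
    {p : ℝ} (ν : ℝ) {B : ℝ} (hW0 : ∀ t, 0 ≤ W t) (hB : 0 < B) (hWi : Integrable W μ)
    (hWp : Integrable (fun t => W t ^ p) μ) :
    Integrable (fun t => tangentDeficit p ν (W t / B)) μ := by
  unfold tangentDeficit
  have h1 : (fun t => (W t / B) ^ p) = fun t => W t ^ p / B ^ p := by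
    ext t
    rw [Real.div_rpow (hW0 t) hB.le]
  refine Integrable.sub ?_ ?_
  · rw [h1]; exact hWp.div_const _
  · exact ((((hWi.div_const B).const_mul _).sub (integrable_const _))).div_const _

/-- The tangent deficit of `w / B` has nonpositive integral over the sublevel set `{w < B}`. -/
theorem setIntegral_sublevel_tangentDeficit_nonpos {p ν B : ℝ} {W : ℝ → ℝ} (hp : 1 < p)
    (hν : 0 < ν) (hB : 0 < B) (hWm : Measurable W) (hW0 : ∀ t, 0 ≤ W t)
    (hWi : IntegrableOn W (Ioo 0 1))
    (hWp : IntegrableOn (fun t => W t ^ p) (Ioo 0 1))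
    (hRH : ∀ a b A, 0 ≤ a → a < b → b ≤ 1 → 0 < A → ∫ t in Ioo a b, W t = A * (b - a) →
      ∫ t in Ioo a b, W t ^ p ≤ (A * (1 + ν)) ^ p / (1 + p * ν) * (b - a))
    (hBW : B ≤ (1 + ν) * ∫ t in Ioo 0 1, W t) :
    ∫ t in Ioo 0 1, (if W t < B then tangentDeficit p ν (W t / B) else 0) ≤ 0 := by
  have hκ : 0 < 1 + ν := by linarith
  have hq : 0 < 1 + p * ν := by positivity
  set A := B / (1 + ν) with hA
  have hA0 : 0 < A := div_pos hB hκ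
  set V : ℝ → ℝ := (Ioo 0 1).indicator W with hV
  have hVi : Integrable V := hWi.integrable_indicator measurableSet_Ioo
  have hVloc : ∀ a b : ℝ, IntervalIntegrable (fun t => V t - A) volume a b := fun a b =>
    hVi.intervalIntegrable.sub intervalIntegrable_const
  set F : ℝ → ℝ := fun x => ∫ t in (0 : ℝ)..x, (V t - A) with hF
  have hFc : Continuous F := intervalIntegral.continuous_primitive hVloc 0
  have hFab : ∀ a b, 0 ≤ a → a ≤ b → b ≤ 1 → F b - F a = (∫ t in Ioo a b, W t) - A * (b - a) := by
    intro a b ha hab hb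
    rw [hF, intervalIntegral.integral_interval_sub_left (hVloc _ _) (hVloc _ _),
      intervalIntegral.integral_sub hVi.intervalIntegrable intervalIntegrable_const,
      intervalIntegral.integral_const, intervalIntegral.integral_of_le hab,
      integral_Ioc_eq_integral_Ioo, smul_eq_mul, mul_comm A]
    congr 1
    refine setIntegral_congr_fun measurableSet_Ioo fun t ht => ?_
    exact indicator_of_mem (show t ∈ Ioo (0 : ℝ) 1 from ⟨ha.trans_lt ht.1, ht.2.trans_le hb⟩) _
  have hDi : IntegrableOn (fun t => tangentDeficit p ν (W t / B)) (Ioo 0 1) :=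
    integrable_tangentDeficit_comp_div ν hW0 hB hWi hWp
  set g : ℝ → ℝ := (Ioo 0 1).indicator fun t => tangentDeficit p ν (W t / B) with hg
  have hgi : Integrable g := hDi.integrable_indicator measurableSet_Ioo
  have hgab : ∀ a b, 0 ≤ a → a < b → b ≤ 1 → F a = F b → ∫ t in Ioo a b, g t ≤ 0 := by
    intro a b ha hab hb hFe
    have hsub : Ioo a b ⊆ Ioo 0 1 := Ioo_subset_Ioo ha hb
    have hWe : ∫ t in Ioo a b, W t = A * (b - a) := by
      have := hFab a b ha hab.le hb
      rw [hFe, sub_self] at this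
      linarith
    have hP := hRH a b A ha hab hb hA0 hWe
    have hge : ∫ t in Ioo a b, g t = (∫ t in Ioo a b, W t ^ p) / B ^ p
        - (p * (1 + ν) * ((∫ t in Ioo a b, W t) / B) - (p - 1) * (b - a)) / (1 + p * ν) := by
      have hWi' : Integrable W (volume.restrict (Ioo a b)) := hWi.mono_set hsub
      have hWp' : Integrable (fun t => W t ^ p) (volume.restrict (Ioo a b)) := hWp.mono_set hsub
      have hL : Integrable (fun t => (p * (1 + ν) * (W t / B) - (p - 1)) / (1 + p * ν))
          (volume.restrict (Ioo a b)) :=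
        (((hWi'.div_const B).const_mul _).sub (integrable_const _)).div_const _
      rw [setIntegral_congr_fun (g := fun t => W t ^ p / B ^ p
        - (p * (1 + ν) * (W t / B) - (p - 1)) / (1 + p * ν)) measurableSet_Ioo]
      · rw [integral_sub (hWp'.div_const _)
          hL,
          integral_div, integral_div, integral_sub ((hWi'.div_const B).const_mul _)
          (integrable_const _), integral_const_mul, integral_div, integral_const]
        simp [hab.le]
        ring
      · intro t ht
        simp only [hg, indicator_of_mem (hsub ht), tangentDeficit]
        rw [Real.div_rpow (hW0 t) hB.le]
    have hAB : A * (1 + ν) = B := div_mul_cancel₀ _ hκ.ne'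
    have hBp := Real.rpow_pos_of_pos hB p
    rw [hAB] at hP
    have h1 : (∫ t in Ioo a b, W t ^ p) / B ^ p ≤ (b - a) / (1 + p * ν) := by
      rw [div_le_iff₀ hBp]
      calc _ ≤ _ := hP
        _ = _ := by ring
    have h2 : (p * (1 + ν) * ((∫ t in Ioo a b, W t) / B) - (p - 1) * (b - a)) / (1 + p * ν) =
        (b - a) / (1 + p * ν) := by
      rw [hWe, hA]
      field_simp
      ring
    rw [hge, h2]
    linarith
  have hF01 : F 0 ≤ F 1 := by
    have := hFab 0 1 le_rfl zero_le_one le_rfl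
    have h2 : A ≤ ∫ t in Ioo 0 1, W t := by
      rw [hA, div_le_iff₀ hκ]
      linarith
    linarith
  obtain ⟨U, hUo, hU01, hUg, hUF⟩ := exists_risingSun hFc hF01 hgi hgab
  have hderiv : ∀ᵐ x, x ∈ Ioo (0 : ℝ) 1 → x ∉ U → A ≤ W x := by
    have hVlocI : LocallyIntegrable (fun t => V t - A) :=
      hVi.locallyIntegrable.sub (locallyIntegrable_const A)
    filter_upwards [LocallyIntegrable.ae_hasDerivAt_integral hVlocI] with x hx hx01 hxU
    have hd := (hasDerivAt_iff_tendsto_slope_left_right.1 (hx 0)).1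
    have h0 : 0 ≤ V x - A := by
      refine ge_of_tendsto hd ?_
      filter_upwards [Ioo_mem_nhdsLT hx01.1] with y hy
      rw [slope_def_field]
      refine div_nonneg_of_nonpos ?_ ?_
      · exact sub_nonpos.2 (hUF x hx01 hxU y hy.1.le hy.2)
      · linarith [hy.2]
    rw [hV, indicator_of_mem hx01] at h0
    linarith
  have hUm : MeasurableSet U := hUo.measurableSet
  calc ∫ t in Ioo 0 1, (if W t < B then tangentDeficit p ν (W t / B) else 0)
      ≤ ∫ t in Ioo 0 1, U.indicator g t := by
        refine integral_mono_ae ?_ (hgi.indicator hUm).integrableOn ?_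
        · exact hDi.indicator (measurableSet_lt hWm measurable_const)
        · filter_upwards [ae_restrict_of_ae hderiv, ae_restrict_mem measurableSet_Ioo] with x hx hx01
          have hgx : g x = tangentDeficit p ν (W x / B) := indicator_of_mem hx01 _
          by_cases hxU : x ∈ U
          · rw [indicator_of_mem hxU, hgx]
            split_ifs with hlt
            · exact le_rfl
            · exact tangentDeficit_nonneg hp hν ((one_le_div hB).2 (not_lt.1 hlt))
          · rw [indicator_of_notMem hxU]
            split_ifs with hlt
            · refine tangentDeficit_nonpos hp hν ?_ ((div_le_one hB).2 hlt.le)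
              have := hx hx01 hxU
              rw [hA, div_le_iff₀ hκ] at this
              rw [div_le_div_iff₀ hκ hB]
              linarith
            · exact le_rfl
    _ = ∫ t in U, g t := by
        rw [setIntegral_indicator hUm, inter_eq_self_of_subset_right hU01]
    _ ≤ 0 := hUg

theorem integrable_deficitPrimitive_comp_div {μ : Measure ℝ} [IsFiniteMeasure μ] {W : ℝ → ℝ}
    {p : ℝ} (ν α : ℝ) {c : ℝ} (hW0 : ∀ t, 0 ≤ W t) (hc : 0 < c) (hWi : Integrable W μ)
    (hWp : Integrable (fun t => W t ^ p) μ) :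
    Integrable (fun t => deficitPrimitive p ν α (W t / c)) μ := by
  unfold deficitPrimitive
  have h1 : (fun t => (W t / c) ^ p / (p + α)) = fun t => W t ^ p / c ^ p / (p + α) := by
    ext t
    rw [Real.div_rpow (hW0 t) hc.le]
  refine Integrable.add (Integrable.sub ?_ ?_) (integrable_const _)
  · rw [h1]; exact (hWp.div_const _).div_const _
  · exact ((hWi.div_const c).const_mul _).div_const _

theorem integral_max_rpow_neg_le {p ν α ε c : ℝ} {W : ℝ → ℝ} (hp : 1 < p)
    (hν : 0 < ν) (hα : 0 < α) (hαν : α * ν < 1) (hε : 0 < ε) (hεc : ε < c)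
    (hWm : Measurable W) (hW0 : ∀ t, 0 ≤ W t) (hWi : IntegrableOn W (Ioo 0 1))
    (hWp : IntegrableOn (fun t => W t ^ p) (Ioo 0 1))
    (hRH : ∀ a b A, 0 ≤ a → a < b → b ≤ 1 → 0 < A → ∫ t in Ioo a b, W t = A * (b - a) →
      ∫ t in Ioo a b, W t ^ p ≤ (A * (1 + ν)) ^ p / (1 + p * ν) * (b - a))
    (hcW : c ≤ (1 + ν) * ∫ t in Ioo 0 1, W t) :
    deficitPrimitive p ν α 1 * ∫ t in Ioo 0 1, (max (W t) ε) ^ (-α) ≤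
      c ^ (-α) * ∫ t in Ioo 0 1, deficitPrimitive p ν α (W t / c) := by
  have hc : 0 < c := hε.trans hεc
  set f : ℝ → ℝ → ℝ := fun B t =>
    B ^ (-α - 1) * (if W t < B then tangentDeficit p ν (W t / B) else 0) with hf
  have hDc : Continuous (tangentDeficit p ν) := continuous_tangentDeficit hp
  have hfm : Measurable (Function.uncurry f) := by
    have h1 : Measurable fun z : ℝ × ℝ => W z.2 := hWm.comp measurable_snd
    have h2 : Measurable fun z : ℝ × ℝ => tangentDeficit p ν (W z.2 / z.1) :=
      hDc.measurable.comp (h1.div measurable_fst)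
    exact (measurable_fst.pow_const _).mul
      (Measurable.ite (measurableSet_lt h1 measurable_fst) h2 measurable_const)
  obtain ⟨K, hK⟩ := isCompact_Icc.exists_bound_of_continuousOn
    (hDc.continuousOn (s := Icc (0 : ℝ) 1))
  have hfi : Integrable (Function.uncurry f)
      ((volume.restrict (uIoc ε c)).prod (volume.restrict (Ioo 0 1))) := by
    rw [uIoc_of_le hεc.le]
    refine Integrable.of_bound hfm.aestronglyMeasurable (ε ^ (-α - 1) * K) ?_
    rw [Measure.prod_restrict]
    filter_upwards [ae_restrict_mem (measurableSet_Ioc.prod measurableSet_Ioo)] with z hz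
    obtain ⟨B, t⟩ := z
    have hB : ε < B := hz.1.1
    have hB0 : 0 < B := hε.trans hB
    have hK0 : 0 ≤ K := (norm_nonneg _).trans (hK 0 ⟨le_rfl, zero_le_one⟩)
    simp only [Function.uncurry, hf, norm_mul]
    refine mul_le_mul ?_ ?_ (norm_nonneg _) (Real.rpow_nonneg hε.le _)
    · rw [Real.norm_of_nonneg (Real.rpow_nonneg hB0.le _)]
      exact Real.rpow_le_rpow_of_nonpos hε hB.le (by linarith)
    · split_ifs with hlt
      · exact hK _ ⟨div_nonneg (hW0 t) hB0.le, (div_le_one hB0).2 hlt.le⟩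
      · simpa using hK0
  have hswap := intervalIntegral_integral_swap hfi
  have hleft : ∫ B in ε..c, ∫ t in Ioo 0 1, f B t ≤ 0 := by
    rw [intervalIntegral.integral_of_le hεc.le]
    refine setIntegral_nonpos measurableSet_Ioc fun B hB => ?_
    have hB0 : 0 < B := hε.trans hB.1
    simp only [hf]
    rw [integral_const_mul]
    exact mul_nonpos_of_nonneg_of_nonpos (Real.rpow_nonneg hB0.le _)
      (setIntegral_sublevel_tangentDeficit_nonpos hp hν hB0 hWm hW0 hWi hWp hRH (hB.2.trans hcW))
  have hmi : IntegrableOn (fun t => (max (W t) ε) ^ (-α)) (Ioo 0 1) := by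
    refine Integrable.of_bound ((hWm.max measurable_const).pow_const _).aestronglyMeasurable
      (ε ^ (-α)) (ae_of_all _ fun t => ?_)
    have h0 : 0 < max (W t) ε := lt_max_of_lt_right hε
    rw [Real.norm_of_nonneg (Real.rpow_nonneg h0.le _)]
    exact Real.rpow_le_rpow_of_nonpos hε (le_max_right _ _) (by linarith)
  have hQi : IntegrableOn (fun t => deficitPrimitive p ν α (W t / c)) (Ioo 0 1) :=
    integrable_deficitPrimitive_comp_div ν α hW0 hc hWi hWp
  have hfi2 : Integrable (fun t => ∫ B in ε..c, f B t) (volume.restrict (Ioo 0 1)) := by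
    simp only [intervalIntegral.integral_of_le hεc.le]
    rw [uIoc_of_le hεc.le] at hfi
    exact hfi.integral_prod_right
  have hmono : ∫ t in Ioo 0 1, (deficitPrimitive p ν α 1 * (max (W t) ε) ^ (-α)
      - c ^ (-α) * deficitPrimitive p ν α (W t / c)) ≤ ∫ t in Ioo 0 1, ∫ B in ε..c, f B t :=
    integral_mono ((Integrable.const_mul hmi _).sub (Integrable.const_mul hQi _)) hfi2 fun t =>
      le_integral_level_tangentDeficit hp hν hα hαν (hW0 t) hε hεc
  rw [integral_sub (Integrable.const_mul hmi _) (Integrable.const_mul hQi _), integral_const_mul,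
    integral_const_mul] at hmono
  linarith

theorem lintegral_rpow_neg_le_of_integral_max {α c K : ℝ} {W : ℝ → ℝ} (hα : 0 < α) (hc : 0 < c)
    (hWm : Measurable W)
    (h : ∀ ε, 0 < ε → ε < c → ∫ t in Ioo 0 1, (max (W t) ε) ^ (-α) ≤ K) :
    ∫⁻ t in Ioo 0 1, ENNReal.ofReal (W t) ^ (-α) ≤ ENNReal.ofReal K := by
  set e : ℕ → ℝ := fun n => c / (n + 2) with he
  have he0 : ∀ n, 0 < e n := fun n => by positivity
  have hec : ∀ n, e n < c := fun n => by
    rw [he, div_lt_iff₀ (by positivity)]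
    nlinarith [n.cast_nonneg (α := ℝ)]
  have helim : Filter.Tendsto e Filter.atTop (nhds 0) :=
    Filter.Tendsto.const_div_atTop
      (Filter.tendsto_atTop_add_const_right _ _ tendsto_natCast_atTop_atTop) _
  have hlim : ∀ t, ENNReal.ofReal (W t) ^ (-α) =
      Filter.liminf (fun n => ENNReal.ofReal (max (W t) (e n)) ^ (-α)) Filter.atTop := by
    intro t
    refine (Filter.Tendsto.liminf_eq ?_).symm
    have h1 : Filter.Tendsto (fun n => ENNReal.ofReal (max (W t) (e n))) Filter.atTop
        (nhds (ENNReal.ofReal (max (W t) 0))) :=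
      (ENNReal.continuous_ofReal.tendsto _).comp (tendsto_const_nhds.max helim)
    have h2 : ENNReal.ofReal (max (W t) 0) = ENNReal.ofReal (W t) := by
      rcases le_total (W t) 0 with h | h
      · rw [max_eq_right h, ENNReal.ofReal_zero, ENNReal.ofReal_of_nonpos h]
      · rw [max_eq_left h]
    rw [h2] at h1
    exact (ENNReal.continuous_rpow_const.tendsto _).comp h1
  simp_rw [hlim]
  refine (lintegral_liminf_le fun n => ?_).trans ?_
  · exact (ENNReal.measurable_ofReal.comp (hWm.max measurable_const)).pow_const _
  · refine Filter.liminf_le_of_frequently_le' (Filter.Frequently.of_forall fun n => ?_)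
    have h0 : ∀ t, 0 < max (W t) (e n) := fun t => lt_max_of_lt_right (he0 n)
    simp_rw [fun t => ENNReal.ofReal_rpow_of_pos (p := -α) (h0 t)]
    rw [← ofReal_integral_eq_lintegral_ofReal]
    · exact ENNReal.ofReal_le_ofReal (h _ (he0 n) (hec n))
    · refine Integrable.of_bound ((hWm.max measurable_const).pow_const _).aestronglyMeasurable
        (e n ^ (-α)) (ae_of_all _ fun t => ?_)
      rw [Real.norm_of_nonneg (Real.rpow_nonneg (h0 t).le _)]
      exact Real.rpow_le_rpow_of_nonpos (he0 n) (le_max_right _ _) (by linarith)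
    · exact ae_of_all _ fun t => Real.rpow_nonneg (h0 t).le _

/-- The sharp upper bound for the negative moment, for real-valued functions. -/
theorem lintegral_rpow_neg_le {p ν α c τ : ℝ} {W : ℝ → ℝ} (hp : 1 < p)
    (hν : 0 < ν) (hα : 0 < α) (hαν : α * ν < 1) (hc : 0 < c) (hτ : τ ≤ 1)
    (hWm : Measurable W) (hW0 : ∀ t, 0 ≤ W t) (hWi : IntegrableOn W (Ioo 0 1))
    (hWp : IntegrableOn (fun t => W t ^ p) (Ioo 0 1))
    (hRH : ∀ a b A, 0 ≤ a → a < b → b ≤ 1 → 0 < A → ∫ t in Ioo a b, W t = A * (b - a) →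
      ∫ t in Ioo a b, W t ^ p ≤ (A * (1 + ν)) ^ p / (1 + p * ν) * (b - a))
    (h1 : ∫ t in Ioo 0 1, W t = c * (1 - τ * (ν / (1 + ν))))
    (h2 : ∫ t in Ioo 0 1, W t ^ p = c ^ p * (1 - τ * (p * ν / (1 + p * ν)))) :
    ∫⁻ t in Ioo 0 1, ENNReal.ofReal (W t) ^ (-α) ≤
      ENNReal.ofReal (c ^ (-α) * (1 + τ * (α * ν / (1 - α * ν)))) := by
  have hκ : 0 < 1 + ν := by linarith
  have hq : 0 < 1 + p * ν := by positivity
  have hd : 0 < 1 - α * ν := by linarith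
  have hQ1 := deficitPrimitive_one hp hν hα
  have hQpos : 0 < deficitPrimitive p ν α 1 := by
    rw [hQ1]
    have : 0 < p - 1 := by linarith
    positivity
  have hQ : ∫ t in Ioo 0 1, deficitPrimitive p ν α (W t / c) =
      deficitPrimitive p ν α 1 * (1 + τ * (α * ν / (1 - α * ν))) := by
    have e : ∀ t, deficitPrimitive p ν α (W t / c) = W t ^ p / c ^ p / (p + α)
        - p * (1 + ν) * (W t / c) / ((1 + p * ν) * (1 + α)) + (p - 1) / (α * (1 + p * ν)) := by
      intro t
      rw [deficitPrimitive, Real.div_rpow (hW0 t) hc.le]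
    have i1 : Integrable (fun t => W t ^ p / c ^ p / (p + α)) (volume.restrict (Ioo 0 1)) :=
      (hWp.div_const _).div_const _
    have i2 : Integrable (fun t => p * (1 + ν) * (W t / c) / ((1 + p * ν) * (1 + α)))
        (volume.restrict (Ioo 0 1)) := ((hWi.div_const c).const_mul _).div_const _
    have i3 : Integrable (fun t => W t ^ p / c ^ p / (p + α)
        - p * (1 + ν) * (W t / c) / ((1 + p * ν) * (1 + α))) (volume.restrict (Ioo 0 1)) :=
      i1.sub i2
    simp_rw [e]
    rw [integral_add i3 (integrable_const _), integral_sub i1 i2, integral_div,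
      integral_div, integral_div, integral_const_mul, integral_div, h1, h2, integral_const, hQ1]
    have : 0 < c ^ p := Real.rpow_pos_of_pos hc p
    have : 0 < p + α := by positivity
    have hr : p * (p - 1) * (1 - α * ν) / (α * (1 + α) * (p + α) * (1 + p * ν)) *
        (1 + τ * (α * ν / (1 - α * ν))) = p * (p - 1) * (1 - α * ν + τ * (α * ν)) /
          (α * (1 + α) * (p + α) * (1 + p * ν)) := by
      have : 1 + τ * (α * ν / (1 - α * ν)) = (1 - α * ν + τ * (α * ν)) / (1 - α * ν) := by
        rw [add_div, div_self hd.ne', mul_div_assoc τ]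
      rw [this, div_mul_div_comm, mul_right_comm, mul_div_mul_right _ _ hd.ne']
    rw [hr]
    simp
    field_simp
    ring
  refine lintegral_rpow_neg_le_of_integral_max hα hc hWm fun ε hε hεc => ?_
  have := integral_max_rpow_neg_le hp hν hα hαν hε hεc hWm hW0 hWi hWp hRH (by
    rw [h1]
    have : c * (1 - τ) * ν ≥ 0 := mul_nonneg (mul_nonneg hc.le (by linarith)) hν.le
    field_simp
    nlinarith)
  rw [hQ] at this
  refine le_of_mul_le_mul_left ?_ hQpos
  linarith

theorem rpow_tangent_le {p x y : ℝ} (hp : 1 < p) (hx : 0 ≤ x) (hy : 0 ≤ y) :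
    p * y ^ (p - 1) * (x - y) ≤ x ^ p - y ^ p := by
  rcases eq_or_lt_of_le hy with rfl | hy
  · rw [Real.zero_rpow (by linarith), Real.zero_rpow (by linarith)]
    simpa using Real.rpow_nonneg hx p
  · have h1 := one_add_mul_self_le_rpow_one_add (s := x / y - 1)
      (by linarith [div_nonneg hx hy.le]) hp.le
    rw [add_sub_cancel, Real.div_rpow hx hy.le, le_div_iff₀ (Real.rpow_pos_of_pos hy p)] at h1
    rw [Real.rpow_sub_one hy.ne']
    have e : (1 + p * (x / y - 1)) * y ^ p = y ^ p + p * (y ^ p / y) * (x - y) := by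
      field_simp
    linarith

/-- Truncation from above does not increase the ratio of the `p`-th moment to the `p`-th power of
the mean. -/
theorem integral_min_rpow_mul_le {p a b m : ℝ} {u : ℝ → ℝ} (hp : 1 < p) (hab : a ≤ b)
    (hm : 0 ≤ m) (hu : Continuous u) (hu0 : ∀ t ∈ Icc a b, 0 ≤ u t)
    (hV : 0 < ∫ t in a..b, min (u t) m) :
    (∫ t in a..b, (min (u t) m) ^ p) * (∫ t in a..b, u t) ^ p ≤
      (∫ t in a..b, u t ^ p) * (∫ t in a..b, min (u t) m) ^ p := by
  have hv : Continuous fun t => min (u t) m := hu.min continuous_const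
  have hup : Continuous fun t => u t ^ p := hu.rpow_const fun t => Or.inr (by linarith)
  have hvp : Continuous fun t => (min (u t) m) ^ p := hv.rpow_const fun t => Or.inr (by linarith)
  set V := ∫ t in a..b, min (u t) m with hVdef
  set U := ∫ t in a..b, u t with hUdef
  have hVU : V ≤ U := intervalIntegral.integral_mono_on hab (hv.intervalIntegrable _ _)
    (hu.intervalIntegrable _ _) fun t _ => min_le_left _ _
  have hU : 0 < U := hV.trans_le hVU
  have hpt : ∀ t ∈ Icc a b, p * (m / V) ^ (p - 1) * (u t / U - min (u t) m / V) ≤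
      u t ^ p / U ^ p - (min (u t) m) ^ p / V ^ p := by
    intro t ht
    have h0 := hu0 t ht
    have hv0 : 0 ≤ min (u t) m := le_min h0 hm
    rw [← Real.div_rpow h0 hU.le, ← Real.div_rpow hv0 hV.le]
    have htan := rpow_tangent_le hp (div_nonneg h0 hU.le) (div_nonneg hv0 hV.le)
    rcases le_total m (u t) with h | h
    · rwa [min_eq_right h] at htan ⊢
    · rw [min_eq_left h] at htan ⊢
      refine le_trans ?_ htan
      refine mul_le_mul_of_nonpos_right ?_ ?_
      · gcongr
      · exact sub_nonpos.2 (div_le_div_of_nonneg_left h0 hV hVU)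
  have hmono := intervalIntegral.integral_mono_on (μ := volume) hab
    (Continuous.intervalIntegrable (by fun_prop) _ _)
    (Continuous.intervalIntegrable (by fun_prop) _ _) hpt
  rw [intervalIntegral.integral_const_mul,
    intervalIntegral.integral_sub ((hu.intervalIntegrable _ _).div_const _)
      ((hv.intervalIntegrable _ _).div_const _),
    intervalIntegral.integral_sub ((hup.intervalIntegrable _ _).div_const _)
      ((hvp.intervalIntegrable _ _).div_const _),
    intervalIntegral.integral_div, intervalIntegral.integral_div, intervalIntegral.integral_div,
    intervalIntegral.integral_div, ← hUdef, ← hVdef, div_self hU.ne', div_self hV.ne', sub_self,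
    mul_zero, sub_nonneg,
    div_le_div_iff₀ (Real.rpow_pos_of_pos hV p) (Real.rpow_pos_of_pos hU p)] at hmono
  exact hmono

/-- Power functions satisfy the reverse Hölder inequality with the constant of the intervals
starting at `0`. -/
theorem integral_rpow_mul_le {p ν a b : ℝ} (hp : 1 < p) (hν : 0 < ν) (ha : 0 ≤ a) (hab : a < b) :
    (∫ t in a..b, (t ^ ν) ^ p) * (b - a) ^ (p - 1) ≤
      (1 + ν) ^ p / (1 + p * ν) * (∫ t in a..b, t ^ ν) ^ p := by
  have hb : 0 < b := ha.trans_lt hab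
  have hp0 : 0 < p := by linarith
  have hpν : 0 < p * ν := by positivity
  have hκ : 0 < 1 + ν := by linarith
  have e1 : ∫ t in a..b, (t ^ ν) ^ p = (b ^ (p * ν + 1) - a ^ (p * ν + 1)) / (p * ν + 1) := by
    rw [← integral_rpow (Or.inl (by linarith))]
    refine intervalIntegral.integral_congr fun t ht => ?_
    rw [uIcc_of_le hab.le] at ht
    rw [← Real.rpow_mul (ha.trans ht.1), mul_comm]
  have e2 : ∫ t in a..b, t ^ ν = (b ^ (ν + 1) - a ^ (ν + 1)) / (ν + 1) :=
    integral_rpow (Or.inl (by linarith))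
  obtain ⟨x, hx⟩ : ∃ x, x = a / b := ⟨_, rfl⟩
  have hx0 : 0 ≤ x := hx ▸ div_nonneg ha hb.le
  have hx1 : x ≤ 1 := hx ▸ (div_le_one hb).2 hab.le
  have hax : a = b * x := by rw [hx]; field_simp
  have hy0 : 0 ≤ x ^ (p * ν + 1) := Real.rpow_nonneg hx0 _
  have hy1 : x ^ (p * ν + 1) ≤ 1 := Real.rpow_le_one hx0 hx1 (by linarith)
  have hz1 : x ^ (ν + 1) ≤ 1 := Real.rpow_le_one hx0 hx1 (by linarith)
  have hθ : 1 / p + (1 - 1 / p) = 1 := by ring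
  have hθ1 : 0 ≤ 1 - 1 / p := by
    rw [sub_nonneg, div_le_one hp0]; exact hp.le
  have g1 := Real.geom_mean_le_arith_mean2_weighted (one_div_nonneg.2 hp0.le) hθ1
    (sub_nonneg.2 hy1) (sub_nonneg.2 hx1) hθ
  have g2 := Real.geom_mean_le_arith_mean2_weighted (one_div_nonneg.2 hp0.le) hθ1 hy0 hx0 hθ
  have e3 : (x ^ (p * ν + 1)) ^ (1 / p) * x ^ (1 - 1 / p) = x ^ (ν + 1) := by
    rw [← Real.rpow_mul hx0, ← Real.rpow_add_of_nonneg hx0 (by positivity) hθ1]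
    congr 1
    field_simp
    ring
  rw [e3] at g2
  have g3 : (1 - x ^ (p * ν + 1)) ^ (1 / p) * (1 - x) ^ (1 - 1 / p) ≤ 1 - x ^ (ν + 1) := by
    linarith
  have g4 := Real.rpow_le_rpow (mul_nonneg (Real.rpow_nonneg (sub_nonneg.2 hy1) _)
    (Real.rpow_nonneg (sub_nonneg.2 hx1) _)) g3 hp0.le
  rw [Real.mul_rpow (Real.rpow_nonneg (sub_nonneg.2 hy1) _) (Real.rpow_nonneg (sub_nonneg.2 hx1) _),
    ← Real.rpow_mul (sub_nonneg.2 hy1), ← Real.rpow_mul (sub_nonneg.2 hx1),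
    one_div_mul_cancel hp0.ne', Real.rpow_one,
    show (1 - 1 / p) * p = p - 1 by field_simp] at g4
  have e4 : b ^ (p * ν + 1) - a ^ (p * ν + 1) = b ^ (p * ν + 1) * (1 - x ^ (p * ν + 1)) := by
    rw [hax, Real.mul_rpow hb.le hx0]; ring
  have e5 : b ^ (ν + 1) - a ^ (ν + 1) = b ^ (ν + 1) * (1 - x ^ (ν + 1)) := by
    rw [hax, Real.mul_rpow hb.le hx0]; ring
  have e6 : b - a = b * (1 - x) := by rw [hax]; ring
  have e7 : b ^ (p * ν + 1) * b ^ (p - 1) = (b ^ (ν + 1)) ^ p := by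
    rw [← Real.rpow_add hb, ← Real.rpow_mul hb.le]; congr 1; ring
  have g5 : (b ^ (p * ν + 1) - a ^ (p * ν + 1)) * (b - a) ^ (p - 1) ≤
      (b ^ (ν + 1) - a ^ (ν + 1)) ^ p := by
    rw [e4, e5, e6, Real.mul_rpow hb.le (sub_nonneg.2 hx1),
      Real.mul_rpow (Real.rpow_nonneg hb.le _) (sub_nonneg.2 hz1), ← e7]
    have := mul_le_mul_of_nonneg_left g4
      (show 0 ≤ b ^ (p * ν + 1) * b ^ (p - 1) by positivity)
    linarith
  have hz : 0 ≤ b ^ (ν + 1) - a ^ (ν + 1) :=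
    sub_nonneg.2 (Real.rpow_le_rpow ha hab.le (by linarith))
  rw [e1, e2, Real.div_rpow hz (by linarith), add_comm ν 1, add_comm (p * ν) 1] at *
  have hκp := Real.rpow_pos_of_pos hκ p
  have e8 : (1 + ν) ^ p / (1 + p * ν) * ((b ^ (1 + ν) - a ^ (1 + ν)) ^ p / (1 + ν) ^ p) =
      (b ^ (1 + ν) - a ^ (1 + ν)) ^ p / (1 + p * ν) := by
    field_simp
  rw [e8, div_mul_eq_mul_div]
  gcongr

theorem integral_min_rpow_rpow_mul_le {p ν τ a b : ℝ} (hp : 1 < p) (hν : 0 < ν) (hτ : 0 < τ)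
    (ha : 0 ≤ a) (hab : a < b) :
    (∫ t in a..b, (min (t ^ ν) (τ ^ ν)) ^ p) * (b - a) ^ (p - 1) ≤
      (1 + ν) ^ p / (1 + p * ν) * (∫ t in a..b, min (t ^ ν) (τ ^ ν)) ^ p := by
  have hc : Continuous fun t : ℝ => t ^ ν := Real.continuous_rpow_const hν.le
  have hm : 0 < τ ^ ν := Real.rpow_pos_of_pos hτ ν
  have hpos : ∀ t ∈ Ioo a b, 0 < t ^ ν := fun t ht => Real.rpow_pos_of_pos (ha.trans_lt ht.1) ν
  have hV : 0 < ∫ t in a..b, min (t ^ ν) (τ ^ ν) :=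
    intervalIntegral.intervalIntegral_pos_of_pos_on
      ((hc.min continuous_const).intervalIntegrable _ _) (fun t ht => lt_min (hpos t ht) hm) hab
  have hU : 0 < ∫ t in a..b, t ^ ν :=
    intervalIntegral.intervalIntegral_pos_of_pos_on (hc.intervalIntegrable _ _) hpos hab
  have h1 := integral_min_rpow_mul_le hp hab.le hm.le hc
    (fun t ht => Real.rpow_nonneg (ha.trans ht.1) ν) hV
  have h2 := integral_rpow_mul_le hp hν ha hab
  have hUp := Real.rpow_pos_of_pos hU p
  have hVp := Real.rpow_pos_of_pos hV p
  have hd : 0 ≤ (b - a) ^ (p - 1) := Real.rpow_nonneg (by linarith) _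
  refine le_of_mul_le_mul_right ?_ hUp
  calc _ = (∫ t in a..b, (min (t ^ ν) (τ ^ ν)) ^ p) * (∫ t in a..b, t ^ ν) ^ p *
        (b - a) ^ (p - 1) := by ring
    _ ≤ (∫ t in a..b, (t ^ ν) ^ p) * (∫ t in a..b, min (t ^ ν) (τ ^ ν)) ^ p *
        (b - a) ^ (p - 1) := mul_le_mul_of_nonneg_right h1 hd
    _ = (∫ t in a..b, (t ^ ν) ^ p) * (b - a) ^ (p - 1) *
        (∫ t in a..b, min (t ^ ν) (τ ^ ν)) ^ p := by ring
    _ ≤ _ := mul_le_mul_of_nonneg_right h2 hVp.le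
    _ = _ := by ring

theorem integral_min_div_rpow {s τ : ℝ} (hs : -1 < s) (hτ0 : 0 < τ) (hτ : τ ≤ 1) :
    IntervalIntegrable (fun t => (min (t / τ) 1) ^ s) volume 0 1 ∧
      ∫ t in (0 : ℝ)..1, (min (t / τ) 1) ^ s = 1 - τ * (s / (1 + s)) := by
  have c1 : EqOn (fun t => (t / τ) ^ s) (fun t => (min (t / τ) 1) ^ s) (uIcc 0 τ) := by
    intro t ht
    rw [uIcc_of_le hτ0.le] at ht
    simp only
    rw [min_eq_left ((div_le_one hτ0).2 ht.2)]
  have c2 : EqOn (fun _ => (1 : ℝ)) (fun t => (min (t / τ) 1) ^ s) (uIcc τ 1) := by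
    intro t ht
    rw [uIcc_of_le hτ] at ht
    simp only
    rw [min_eq_right ((one_le_div hτ0).2 ht.1), Real.one_rpow]
  have i0 : IntervalIntegrable (fun t : ℝ => (t / τ) ^ s) volume 0 τ := by
    have := (intervalIntegral.intervalIntegrable_rpow' hs (a := 0) (b := 1)).comp_mul_right
      (c := τ⁻¹)
    simpa [div_eq_mul_inv] using this
  have i1 : IntervalIntegrable (fun t => (min (t / τ) 1) ^ s) volume 0 τ :=
    i0.congr fun t ht => c1 (uIoc_subset_uIcc ht)
  have i2 : IntervalIntegrable (fun t => (min (t / τ) 1) ^ s) volume τ 1 :=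
    intervalIntegrable_const.congr fun t ht => c2 (uIoc_subset_uIcc ht)
  refine ⟨i1.trans i2, ?_⟩
  rw [← intervalIntegral.integral_add_adjacent_intervals i1 i2,
    ← intervalIntegral.integral_congr c1, ← intervalIntegral.integral_congr c2,
    intervalIntegral.integral_comp_div (fun t => t ^ s) hτ0.ne', zero_div, div_self hτ0.ne',
    integral_rpow (Or.inl hs), Real.one_rpow, Real.zero_rpow (by linarith),
    intervalIntegral.integral_const]
  have : 1 + s ≠ 0 := by linarith
  have : s + 1 ≠ 0 := by linarith
  simp only [smul_eq_mul]
  field_simp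
  ring

theorem avgE_zero_one (f : ℝ → ℝ≥0∞) : avgE f 0 1 = ∫⁻ t in Ioo (0 : ℝ) 1, f t := by
  simp [avgE]

theorem avgE_rpow_neg_le {p δ ν α c τ : ℝ} {w : ℝ → ℝ≥0∞} (hp : 1 < p) (hδ : 0 < δ) (hν : 0 < ν)
    (hα : 0 < α) (hαν : α * ν < 1) (hc : 0 < c) (hτ : τ ≤ 1) (hδν : (1 + ν) ^ p = δ ^ p * (1 + p * ν))
    (hw : MemRH p δ 0 1 w)
    (h1 : avgE w 0 1 = ENNReal.ofReal (c * (1 - τ * (ν / (1 + ν)))))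
    (h2 : avgE (fun t => w t ^ p) 0 1 = ENNReal.ofReal (c ^ p * (1 - τ * (p * ν / (1 + p * ν))))) :
    avgE (fun t => w t ^ (-α)) 0 1
      ≤ ENNReal.ofReal (c ^ (-α) * (1 + τ * (α * ν / (1 - α * ν)))) := by
  obtain ⟨hwm, hwt, hRH⟩ := hw
  rw [avgE_zero_one] at h1 h2 ⊢
  have hp0 : 0 < p := by linarith
  have hX1 : 0 ≤ c * (1 - τ * (ν / (1 + ν))) := by
    have : τ * (ν / (1 + ν)) ≤ 1 * 1 := by
      have : ν / (1 + ν) ≤ 1 := by rw [div_le_one (by linarith)]; linarith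
      have : 0 ≤ ν / (1 + ν) := by positivity
      nlinarith
    exact mul_nonneg hc.le (by linarith)
  have hX2 : 0 ≤ c ^ p * (1 - τ * (p * ν / (1 + p * ν))) := by
    have h0 : 0 < p * ν := by positivity
    have : τ * (p * ν / (1 + p * ν)) ≤ 1 * 1 := by
      have : p * ν / (1 + p * ν) ≤ 1 := by rw [div_le_one (by linarith)]; linarith
      have : 0 ≤ p * ν / (1 + p * ν) := by positivity
      nlinarith
    exact mul_nonneg (by positivity) (by linarith)
  have hwpt : ∫⁻ t in Ioo (0 : ℝ) 1, w t ^ p ≠ ⊤ := by rw [h2]; exact ofReal_ne_top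
  have hfin : ∀ᵐ t ∂volume.restrict (Ioo (0 : ℝ) 1), w t < ⊤ := ae_lt_top hwm hwt
  have hsub : ∀ {a b : ℝ}, 0 ≤ a → b ≤ 1 → Ioo a b ⊆ Ioo (0 : ℝ) 1 := fun ha hb =>
    Ioo_subset_Ioo ha hb
  have hI : ∀ {a b : ℝ}, 0 ≤ a → b ≤ 1 →
      ENNReal.ofReal (∫ t in Ioo a b, (w t).toReal) = ∫⁻ t in Ioo a b, w t := by
    intro a b ha hb
    rw [integral_toReal hwm.aemeasurable (ae_restrict_of_ae_restrict_of_subset (hsub ha hb) hfin),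
      ofReal_toReal (ne_top_of_le_ne_top hwt (lintegral_mono_set (hsub ha hb)))]
  have hIp : ∀ {a b : ℝ}, 0 ≤ a → b ≤ 1 →
      ∫ t in Ioo a b, (w t).toReal ^ p = (∫⁻ t in Ioo a b, w t ^ p).toReal := by
    intro a b ha hb
    simp_rw [ENNReal.toReal_rpow]
    refine integral_toReal (hwm.pow_const p).aemeasurable ?_
    filter_upwards [ae_restrict_of_ae_restrict_of_subset (hsub ha hb) hfin] with t ht
    exact rpow_lt_top_of_nonneg hp0.le ht.ne
  have hmain := lintegral_rpow_neg_le (W := fun t => (w t).toReal) hp hν hα hαν hc hτ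
    hwm.ennreal_toReal (fun t => toReal_nonneg)
    (integrable_toReal_of_lintegral_ne_top hwm.aemeasurable hwt)
    (by
      simp_rw [ENNReal.toReal_rpow]
      exact integrable_toReal_of_lintegral_ne_top (hwm.pow_const p).aemeasurable hwpt)
    (by
      intro a b A ha hab hb hA hAeq
      have hba : 0 < b - a := by linarith
      have hav : avgE w a b = ENNReal.ofReal A := by
        rw [avgE, ← hI ha hb, hAeq, ← ofReal_div_of_pos hba, mul_div_cancel_right₀ _ hba.ne']
      have h := hRH a b ha hab hb
      rw [hav, avgE, ofReal_rpow_of_pos hδ, ofReal_rpow_of_pos hA,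
        ← ofReal_mul (by positivity), ENNReal.div_le_iff (by simpa using hab) ofReal_ne_top,
        ← ofReal_mul (by positivity)] at h
      rw [hIp ha hb]
      refine (toReal_le_of_le_ofReal (by positivity) h).trans_eq ?_
      rw [Real.mul_rpow hA.le (by linarith), hδν]
      field_simp)
    (by
      rw [integral_toReal hwm.aemeasurable hfin, h1, toReal_ofReal hX1])
    (by
      rw [hIp le_rfl le_rfl, h2, toReal_ofReal hX2])
  refine (lintegral_congr_ae ?_).trans_le hmain
  filter_upwards [hfin] with t ht
  rw [ofReal_toReal ht.ne]

theorem lintegral_Ioo_ofReal {f : ℝ → ℝ} {a b : ℝ} (hab : a ≤ b)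
    (hf : IntervalIntegrable f volume a b) (h0 : ∀ t ∈ Ioo a b, 0 ≤ f t) :
    ∫⁻ t in Ioo a b, ENNReal.ofReal (f t) = ENNReal.ofReal (∫ t in a..b, f t) := by
  rw [intervalIntegral.integral_of_le hab, integral_Ioc_eq_integral_Ioo,
    ofReal_integral_eq_lintegral_ofReal]
  · exact ((intervalIntegrable_iff_integrableOn_Ioo_of_le hab).1 hf)
  · exact (ae_restrict_iff' measurableSet_Ioo).2 (Filter.Eventually.of_forall h0)

theorem exists_memRH_avgE_rpow_neg_eq {p δ ν α c τ : ℝ} (hp : 1 < p) (hδ : 1 ≤ δ) (hν : 0 < ν)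
    (hαν : α * ν < 1) (hc : 0 < c) (hτ0 : 0 ≤ τ) (hτ : τ ≤ 1)
    (hδν : (1 + ν) ^ p = δ ^ p * (1 + p * ν)) :
    ∃ w : ℝ → ℝ≥0∞, MemRH p δ 0 1 w ∧
      avgE w 0 1 = ENNReal.ofReal (c * (1 - τ * (ν / (1 + ν)))) ∧
      avgE (fun t => w t ^ p) 0 1
        = ENNReal.ofReal (c ^ p * (1 - τ * (p * ν / (1 + p * ν)))) ∧
      avgE (fun t => w t ^ (-α)) 0 1
        = ENNReal.ofReal (c ^ (-α) * (1 + τ * (α * ν / (1 - α * ν)))) := by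
  rcases hτ0.eq_or_lt with rfl | hτ0
  · refine ⟨fun _ => ENNReal.ofReal c, ⟨measurable_const, by simp, ?_⟩, ?_, ?_, ?_⟩
    · intro a b _ hab _
      have hba : ENNReal.ofReal (b - a) ≠ 0 := by simpa using hab
      simp only [avgE, lintegral_const, MeasurableSet.univ, Measure.restrict_apply, univ_inter,
        Real.volume_Ioo]
      rw [ENNReal.mul_div_cancel_right hba ofReal_ne_top,
        ENNReal.mul_div_cancel_right hba ofReal_ne_top]
      refine le_mul_of_one_le_left' (one_le_rpow (by simpa using hδ) (by linarith))
    · simp [avgE]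
    · simp [avgE, ofReal_rpow_of_pos hc]
    · simp [avgE, ofReal_rpow_of_pos hc]
  have hmin : ∀ {t}, 0 < t → 0 < min (t / τ) 1 := fun ht => lt_min (by positivity) one_pos
  have hpow : ∀ {β t}, 0 < t → ENNReal.ofReal (c * min (t / τ) 1 ^ ν) ^ β
      = ENNReal.ofReal (c ^ β * min (t / τ) 1 ^ (β * ν)) := by
    intro β t ht
    have := hmin ht
    rw [ofReal_rpow_of_pos (by positivity), Real.mul_rpow hc.le (by positivity),
      ← Real.rpow_mul this.le, mul_comm ν]
  have havg : ∀ β, -1 < β * ν →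
      ∫⁻ t in Ioo (0 : ℝ) 1, ENNReal.ofReal (c * min (t / τ) 1 ^ ν) ^ β
        = ENNReal.ofReal (c ^ β * (1 - τ * (β * ν / (1 + β * ν)))) := by
    intro β hβ
    obtain ⟨hi, he⟩ := integral_min_div_rpow hβ hτ0 hτ
    rw [setLIntegral_congr_fun measurableSet_Ioo fun t ht => hpow ht.1,
      lintegral_Ioo_ofReal zero_le_one (hi.const_mul _), intervalIntegral.integral_const_mul, he]
    intro t ht
    have := hmin ht.1
    positivity
  have hW1 : ∫⁻ t in Ioo (0 : ℝ) 1, ENNReal.ofReal (c * min (t / τ) 1 ^ ν)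
      = ENNReal.ofReal (c * (1 - τ * (ν / (1 + ν)))) := by
    simpa using havg 1 (by linarith)
  have hpν : 0 < p * ν := by positivity
  refine ⟨fun t => ENNReal.ofReal (c * min (t / τ) 1 ^ ν), ⟨by fun_prop, ?_, ?_⟩, ?_, ?_, ?_⟩
  · rw [hW1]; exact ofReal_ne_top
  · intro a b ha hab hb
    have hba : 0 < b - a := by linarith
    have hτν : 0 < τ ^ ν := by positivity
    have hk : 0 < c / τ ^ ν := by positivity
    have hu : Continuous fun t : ℝ => min (t ^ ν) (τ ^ ν) :=
      (continuous_id.rpow_const fun _ => Or.inr hν.le).min continuous_const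
    have hup : Continuous fun t : ℝ => min (t ^ ν) (τ ^ ν) ^ p :=
      hu.rpow_const fun _ => Or.inr (by linarith)
    have hpos : ∀ t ∈ Ioo a b, 0 < min (t ^ ν) (τ ^ ν) := fun t ht =>
      lt_min (Real.rpow_pos_of_pos (ha.trans_lt ht.1) ν) hτν
    have hw : ∀ t ∈ Ioo a b, c * min (t / τ) 1 ^ ν = c / τ ^ ν * min (t ^ ν) (τ ^ ν) := by
      intro t ht
      have ht0 : 0 < t := ha.trans_lt ht.1
      have : min (t ^ ν) (τ ^ ν) = min (t / τ) 1 ^ ν * τ ^ ν := by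
        rw [← Real.mul_rpow (hmin ht0).le hτ0.le, min_mul_of_nonneg _ _ hτ0.le,
          div_mul_cancel₀ _ hτ0.ne', one_mul]
        rcases le_total t τ with h | h
        · rw [min_eq_left h, min_eq_left (Real.rpow_le_rpow ht0.le h hν.le)]
        · rw [min_eq_right h, min_eq_right (Real.rpow_le_rpow hτ0.le h hν.le)]
      rw [this]
      field_simp
    have hI1 : 0 < ∫ t in a..b, min (t ^ ν) (τ ^ ν) :=
      intervalIntegral.intervalIntegral_pos_of_pos_on (hu.intervalIntegrable _ _) hpos hab
    have e1 : ∫⁻ t in Ioo a b, ENNReal.ofReal (c * min (t / τ) 1 ^ ν)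
        = ENNReal.ofReal (c / τ ^ ν * ∫ t in a..b, min (t ^ ν) (τ ^ ν)) := by
      rw [setLIntegral_congr_fun measurableSet_Ioo fun t ht => congrArg ENNReal.ofReal (hw t ht),
        lintegral_Ioo_ofReal hab.le ((hu.intervalIntegrable _ _).const_mul _),
        intervalIntegral.integral_const_mul]
      exact fun t ht => (mul_pos hk (hpos t ht)).le
    have e2 : ∫⁻ t in Ioo a b, ENNReal.ofReal (c * min (t / τ) 1 ^ ν) ^ p
        = ENNReal.ofReal ((c / τ ^ ν) ^ p * ∫ t in a..b, min (t ^ ν) (τ ^ ν) ^ p) := by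
      have h : ∀ t ∈ Ioo a b, ENNReal.ofReal (c * min (t / τ) 1 ^ ν) ^ p
          = ENNReal.ofReal ((c / τ ^ ν) ^ p * min (t ^ ν) (τ ^ ν) ^ p) := by
        intro t ht
        rw [hw t ht, ofReal_rpow_of_pos (mul_pos hk (hpos t ht)),
          Real.mul_rpow hk.le (hpos t ht).le]
      rw [setLIntegral_congr_fun measurableSet_Ioo h,
        lintegral_Ioo_ofReal hab.le ((hup.intervalIntegrable _ _).const_mul _),
        intervalIntegral.integral_const_mul]
      intro t ht
      have := hpos t ht
      positivity
    have hδν' : (1 + ν) ^ p / (1 + p * ν) = δ ^ p := by rw [hδν]; field_simp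
    have hmain := integral_min_rpow_rpow_mul_le hp hν hτ0 ha hab
    rw [hδν'] at hmain
    rw [avgE, avgE, e1, e2, ← ofReal_div_of_pos hba, ← ofReal_div_of_pos hba,
      ofReal_rpow_of_pos (by linarith), ofReal_rpow_of_pos (by positivity),
      ← ofReal_mul (by positivity)]
    refine ofReal_le_ofReal ?_
    rw [Real.div_rpow (by positivity) hba.le, Real.mul_rpow hk.le hI1.le]
    rw [Real.rpow_sub_one hba.ne'] at hmain
    have h1 := Real.rpow_pos_of_pos hba p
    have h2 := Real.rpow_pos_of_pos hk p
    rw [div_le_iff₀ hba]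
    calc (c / τ ^ ν) ^ p * ∫ t in a..b, min (t ^ ν) (τ ^ ν) ^ p
        = (c / τ ^ ν) ^ p * ((∫ t in a..b, min (t ^ ν) (τ ^ ν) ^ p) * ((b - a) ^ p / (b - a)))
            / ((b - a) ^ p / (b - a)) := by
          rw [← mul_assoc, mul_div_cancel_right₀]; positivity
      _ ≤ (c / τ ^ ν) ^ p * (δ ^ p * (∫ t in a..b, min (t ^ ν) (τ ^ ν)) ^ p)
            / ((b - a) ^ p / (b - a)) := by gcongr
      _ = _ := by generalize c / τ ^ ν = k; field_simp
  · rw [avgE_zero_one, hW1]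
  · rw [avgE_zero_one, havg p (by linarith)]
  · rw [avgE_zero_one, havg (-α) (by linarith)]
    congr 2
    rw [neg_mul, neg_div, mul_neg, sub_neg_eq_add, ← sub_eq_add_neg]

theorem strictAntiOn_ratio {p : ℝ} (hp : 1 < p) :
    StrictAntiOn (fun r : ℝ => (1 - p * r) ^ (p - 1) / (1 - (p - 1) * r) ^ p) (Icc 0 (1 / p)) := by
  have hp0 : 0 < p := by linarith
  have hpos : ∀ r ∈ Icc 0 (1 / p), 0 < 1 - (p - 1) * r := by
    intro r hr
    have := (le_div_iff₀ hp0).1 hr.2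
    rcases hr.1.eq_or_lt with h | h
    · simp [← h]
    · nlinarith
  refine strictAntiOn_of_deriv_neg (convex_Icc _ _) ?_ ?_
  · refine ContinuousOn.div ?_ ?_ fun r hr => (Real.rpow_pos_of_pos (hpos r hr) p).ne'
    · exact (ContinuousOn.rpow_const (by fun_prop) fun r _ => Or.inr (by linarith))
    · exact (ContinuousOn.rpow_const (by fun_prop) fun r _ => Or.inr (by linarith))
  · intro r hr
    rw [interior_Icc] at hr
    have hB := hpos r ⟨hr.1.le, hr.2.le⟩
    have hA : 0 < 1 - p * r := by
      have := (lt_div_iff₀ hp0).1 hr.2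
      linarith
    have h1 : HasDerivAt (fun r : ℝ => (1 - p * r) ^ (p - 1))
        (-p * (p - 1) * (1 - p * r) ^ (p - 1 - 1)) r := by
      have h : HasDerivAt (fun r : ℝ => 1 - p * r) (-p) r := by
        simpa using ((hasDerivAt_id r).const_mul p).const_sub 1
      exact h.rpow_const (Or.inl hA.ne')
    have h2 : HasDerivAt (fun r : ℝ => (1 - (p - 1) * r) ^ p)
        (-(p - 1) * p * (1 - (p - 1) * r) ^ (p - 1)) r := by
      have h : HasDerivAt (fun r : ℝ => 1 - (p - 1) * r) (-(p - 1)) r := by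
        simpa using ((hasDerivAt_id r).const_mul (p - 1)).const_sub 1
      exact h.rpow_const (Or.inl hB.ne')
    rw [HasDerivAt.deriv (h1.fun_div h2 (Real.rpow_pos_of_pos hB p).ne')]
    refine div_neg_of_neg_of_pos ?_ (by positivity)
    have e1 : (1 - p * r) ^ (p - 1) = (1 - p * r) ^ (p - 1 - 1) * (1 - p * r) := by
      rw [← Real.rpow_add_one hA.ne']; ring_nf
    have e2 : (1 - (p - 1) * r) ^ p = (1 - (p - 1) * r) ^ (p - 1) * (1 - (p - 1) * r) := by
      rw [← Real.rpow_add_one hB.ne']; ring_nf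
    rw [e1, e2]
    have hX : 0 < (1 - p * r) ^ (p - 1 - 1) := by positivity
    have hY : 0 < (1 - (p - 1) * r) ^ (p - 1) := by positivity
    have : 0 < p * (p - 1) * r * ((1 - p * r) ^ (p - 1 - 1) * (1 - (p - 1) * r) ^ (p - 1)) := by
      have := hr.1
      have : 0 < p - 1 := by linarith
      positivity
    linarith

theorem ratio_apply_div {p ν : ℝ} (hp : 1 < p) (hν : 0 < ν) :
    (1 - p * (ν / (1 + p * ν))) ^ (p - 1) / (1 - (p - 1) * (ν / (1 + p * ν))) ^ p
      = (1 + p * ν) / (1 + ν) ^ p := by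
  have h0 : 0 < 1 + p * ν := by positivity
  have e1 : 1 - p * (ν / (1 + p * ν)) = 1 / (1 + p * ν) := by field_simp; ring
  have e2 : 1 - (p - 1) * (ν / (1 + p * ν)) = (1 + ν) / (1 + p * ν) := by field_simp; ring
  rw [e1, e2, Real.div_rpow zero_le_one h0.le, Real.div_rpow (by linarith) h0.le, Real.one_rpow,
    Real.rpow_sub_one h0.ne']
  have := Real.rpow_pos_of_pos h0 p
  have : 0 < (1 + ν) ^ p := by positivity
  field_simp

theorem bellman_eq {p ν α c τ s r x : ℝ} (hν : 0 < ν) (hp : 1 < p) (hαν : α * ν < 1)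
    (hc : 0 < c) (hτ1 : τ ≤ 1)
    (hs : s = ν / (1 + p * ν)) (hr : r = s * (1 - τ) / (1 - τ * p * s))
    (hx : x = c * (1 - τ * (ν / (1 + ν)))) :
    x ^ (-α) * ((1 - p * s) / (1 - p * r)) ^ (1 + α) *
      ((1 - (p - 1) * r) / (1 - (p - 1) * s)) ^ α * ((1 - (p + α) * r) / (1 - (p + α) * s))
      = c ^ (-α) * (1 + τ * (α * ν / (1 - α * ν))) := by
  have hP : 0 < 1 + p * ν := by positivity
  have hps : p * s < 1 := by rw [hs, ← mul_div_assoc, div_lt_one hP]; linarith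
  have hD : 0 < 1 - τ * p * s := by
    have : 0 ≤ p * s := by rw [hs]; positivity
    nlinarith
  have hL : 0 < 1 - τ * (ν / (1 + ν)) := by
    have h0 : 0 ≤ ν / (1 + ν) := by positivity
    have h1 : ν / (1 + ν) < 1 := by rw [div_lt_one (by linarith)]; linarith
    nlinarith
  have hs1 : 1 - (p - 1) * s = (1 + ν) / (1 + p * ν) := by rw [hs]; field_simp; ring
  have hs1p : 0 < 1 - (p - 1) * s := by rw [hs1]; positivity
  have hr0 : r * (1 - τ * p * s) = s * (1 - τ) := by rw [hr, div_mul_cancel₀ _ hD.ne']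
  have e1 : (1 - p * s) / (1 - p * r) = 1 - τ * p * s := by
    have h : (1 - p * r) * (1 - τ * p * s) = 1 - p * s := by linear_combination -p * hr0
    have : 1 - p * r ≠ 0 := by
      intro h0; rw [h0] at h; linarith
    rw [div_eq_iff this, ← h]; ring
  have e2 : (1 - (p - 1) * r) / (1 - (p - 1) * s)
      = (1 - τ * (ν / (1 + ν))) / (1 - τ * p * s) := by
    rw [div_eq_div_iff hs1p.ne' hD.ne']
    have h : (1 - (p - 1) * s) * (ν / (1 + ν)) = s := by rw [hs1, hs]; field_simp
    linear_combination (-(p - 1)) * hr0 + τ * h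
  have hN : 0 < 1 - α * ν := by linarith
  have e3 : (1 - (p + α) * r) / (1 - (p + α) * s)
      = (1 + τ * (α * ν / (1 - α * ν))) / (1 - τ * p * s) := by
    have h1 : 1 - (p + α) * s = (1 - α * ν) / (1 + p * ν) := by rw [hs]; field_simp; ring
    have h2 : 0 < 1 - (p + α) * s := by rw [h1]; positivity
    have h : (1 - (p + α) * s) * (α * ν / (1 - α * ν)) = α * s := by
      rw [h1, hs, div_mul_div_comm, mul_comm (1 + p * ν), mul_div_mul_left _ _ hN.ne', mul_div_assoc]
    rw [div_eq_div_iff h2.ne' hD.ne']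
    linear_combination (-(p + α)) * hr0 - τ * h
  rw [e1, e2, e3, hx, Real.mul_rpow hc.le hL.le, Real.div_rpow hL.le hD.le, Real.rpow_add hD,
    Real.rpow_one, Real.rpow_neg hL.le]
  have hLα := Real.rpow_pos_of_pos hL α
  have := Real.rpow_pos_of_pos hD α
  generalize (1 - τ * (ν / (1 + ν))) ^ α = X at hLα ⊢
  generalize 1 + τ * (α * ν / (1 - α * ν)) = Y
  field_simp

theorem exists_parameters {p ν s r x₁ : ℝ} (hp : 1 < p) (hν : 0 < ν)
    (hs : s = ν / (1 + p * ν)) (hr0 : 0 ≤ r) (hrs : r ≤ s) (hx : 0 < x₁) :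
    ∃ c τ, 0 < c ∧ 0 ≤ τ ∧ τ ≤ 1 ∧ r = s * (1 - τ) / (1 - τ * p * s) ∧
      x₁ = c * (1 - τ * (ν / (1 + ν))) ∧
      (1 - p * r) ^ (p - 1) / (1 - (p - 1) * r) ^ p * ((1 + ν) ^ p / (1 + p * ν) * x₁ ^ p)
        = c ^ p * (1 - τ * (p * ν / (1 + p * ν))) := by
  have hP : 0 < 1 + p * ν := by positivity
  have hs0 : 0 < s := by rw [hs]; positivity
  have hps : p * s < 1 := by rw [hs, ← mul_div_assoc, div_lt_one hP]; linarith
  have hpr : 0 < 1 - p * r := by nlinarith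
  obtain ⟨τ, hτ⟩ : ∃ τ, τ = (s - r) / (s * (1 - p * r)) := ⟨_, rfl⟩
  have hτ0 : 0 ≤ τ := by rw [hτ]; exact div_nonneg (by linarith) (by positivity)
  have hτ1 : τ ≤ 1 := by
    rw [hτ, div_le_one (by positivity)]
    nlinarith
  have hL : 0 < 1 - τ * (ν / (1 + ν)) := by
    have h0 : 0 ≤ ν / (1 + ν) := by positivity
    have h1 : ν / (1 + ν) < 1 := by rw [div_lt_one (by linarith)]; linarith
    nlinarith
  have hD : 0 < 1 - τ * p * s := by
    have : 0 ≤ p * s := by positivity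
    nlinarith
  have hτm : τ * (s * (1 - p * r)) = s - r := by rw [hτ, div_mul_cancel₀]; positivity
  have e1 : 1 - p * r = (1 - p * s) / (1 - τ * p * s) := by
    rw [eq_div_iff hD.ne']; linear_combination -p * hτm
  have e1' : 1 - p * s = 1 / (1 + p * ν) := by rw [hs]; field_simp; ring
  have hs1 : 1 - (p - 1) * s = (1 + ν) / (1 + p * ν) := by rw [hs]; field_simp; ring
  have e2 : 1 - (p - 1) * r
      = (1 + ν) / (1 + p * ν) * (1 - τ * (ν / (1 + ν))) / (1 - τ * p * s) := by
    rw [eq_div_iff hD.ne', ← hs1]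
    have h : (1 - (p - 1) * s) * (ν / (1 + ν)) = s := by rw [hs1, hs]; field_simp
    linear_combination (-(p - 1)) * hτm + τ * h
  refine ⟨x₁ / (1 - τ * (ν / (1 + ν))), τ, by positivity, hτ0, hτ1, ?_, ?_, ?_⟩
  · rw [eq_div_iff hD.ne']; linear_combination hτm
  · rw [div_mul_cancel₀ _ hL.ne']
  · have e3 : 1 - τ * (p * ν / (1 + p * ν)) = 1 - τ * p * s := by rw [hs]; ring
    rw [e3, e2, e1, e1', Real.div_rpow (by positivity) hD.le, Real.div_rpow (by positivity) hD.le,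
      Real.mul_rpow (by positivity) hL.le,
      Real.div_rpow (by linarith) hP.le, Real.div_rpow hx.le hL.le, Real.one_rpow,
      Real.rpow_sub_one hP.ne', Real.rpow_sub_one hD.ne']
    have hLp := Real.rpow_pos_of_pos hL p
    have := Real.rpow_pos_of_pos hD p
    have := Real.rpow_pos_of_pos hP p
    have : 0 < (1 + ν) ^ p := by positivity
    have e4 : ((1 + ν) / (1 + p * ν)) ^ p = (1 + ν) ^ p / (1 + p * ν) ^ p :=
      Real.div_rpow (by linarith) hP.le p
    rw [e4]
    generalize (1 - τ * (ν / (1 + ν))) ^ p = X at hLp ⊢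
    generalize 1 - τ * p * s = D at *
    field_simp

theorem statement13 (p δ qs q s r x₁ x₂ : ℝ) (hp : 1 < p) (hδ : 1 < δ)
    (hqs1 : 1 < qs) (hqs : ((qs / δ) ^ p - 1) / (qs - 1) = p) (hq : qs < q)
    (hs1 : 0 ≤ s) (hs2 : s ≤ 1 / p)
    (hs : (1 - p * s) ^ (p - 1) / (1 - (p - 1) * s) ^ p = δ ^ (-p))
    (hx1 : 0 < x₁) (hx2l : x₁ ^ p ≤ x₂) (hx2r : x₂ ≤ (δ * x₁) ^ p)
    (hr1 : 0 ≤ r) (hr2 : r ≤ 1 / p)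
    (hr : (1 - p * r) ^ (p - 1) / (1 - (p - 1) * r) ^ p = x₂ / (δ * x₁) ^ p) :
    sSup { y : ℝ≥0∞ | ∃ w : ℝ → ℝ≥0∞, MemRH p δ 0 1 w ∧
        avgE w 0 1 = ENNReal.ofReal x₁ ∧
        avgE (fun t => w t ^ p) 0 1 = ENNReal.ofReal x₂ ∧
        y = avgE (fun t => w t ^ (1 - q / (q - 1))) 0 1 }
      = ENNReal.ofReal (x₁ ^ (1 - q / (q - 1)) *
          ((1 - p * s) / (1 - p * r)) ^ (q / (q - 1)) *
          ((1 - (p - 1) * r) / (1 - (p - 1) * s)) ^ (q / (q - 1) - 1) *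
          ((1 - (p + q / (q - 1) - 1) * r) / (1 - (p + q / (q - 1) - 1) * s))) := by
  have hp0 : 0 < p := by linarith
  have hδ0 : 0 < δ := by linarith
  obtain ⟨ν, rfl⟩ : ∃ ν, qs = 1 + ν := ⟨qs - 1, by ring⟩
  have hν : 0 < ν := by linarith
  have hP : 0 < 1 + p * ν := by positivity
  have hδp : 0 < δ ^ p := by positivity
  have hx1p : 0 < x₁ ^ p := by positivity
  have hδν : (1 + ν) ^ p = δ ^ p * (1 + p * ν) := by
    rw [div_eq_iff (by linarith), Real.div_rpow (by linarith) hδ0.le] at hqs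
    have h : (1 + ν) ^ p / δ ^ p = 1 + p * ν := by linarith
    rwa [div_eq_iff hδp.ne', mul_comm] at h
  have hanti := strictAntiOn_ratio hp
  have hνmem : ν / (1 + p * ν) ∈ Icc 0 (1 / p) := by
    refine ⟨by positivity, ?_⟩
    rw [div_le_div_iff₀ hP hp0]
    linarith
  have hsν : s = ν / (1 + p * ν) := by
    refine hanti.injOn ⟨hs1, hs2⟩ hνmem ?_
    rw [hs, ratio_apply_div hp hν, hδν, Real.rpow_neg hδ0.le]
    field_simp
  have hrs : r ≤ s := by
    rw [← hanti.le_iff_ge ⟨hs1, hs2⟩ ⟨hr1, hr2⟩]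
    rw [hs, hr, Real.mul_rpow hδ0.le hx1.le, Real.rpow_neg hδ0.le, inv_eq_one_div,
      div_le_div_iff₀ hδp (by positivity)]
    nlinarith
  obtain ⟨c, τ, hc, hτ0, hτ1, hrτ, hx₁, hx₂⟩ := exists_parameters hp hν hsν hr1 hrs hx1
  rw [hr, hδν, Real.mul_rpow hδ0.le hx1.le] at hx₂
  replace hx₂ : x₂ = c ^ p * (1 - τ * (p * ν / (1 + p * ν))) := by
    rw [← hx₂]
    field_simp
  obtain ⟨α, hα⟩ : ∃ α, q / (q - 1) = 1 + α := ⟨q / (q - 1) - 1, by ring⟩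
  have hαq : α * (q - 1) = 1 := by
    rw [div_eq_iff (by linarith)] at hα
    linarith
  have hα0 : 0 < α := pos_of_mul_pos_left (by rw [hαq]; exact one_pos) (by linarith)
  have hαν : α * ν < 1 := by nlinarith
  rw [hα, show 1 - (1 + α) = -α by ring, show 1 + α - 1 = α by ring,
    show p + (1 + α) - 1 = p + α by ring, bellman_eq hν hp hαν hc hτ1 hsν hrτ hx₁, hx₁, hx₂]
  refine le_antisymm (sSup_le ?_) (le_sSup ?_)
  · rintro _ ⟨w, hw, h1, h2, rfl⟩
    exact avgE_rpow_neg_le hp hδ0 hν hα0 hαν hc hτ1 hδν hw h1 h2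
  · obtain ⟨w, hw, h1, h2, h3⟩ :=
      exists_memRH_avgE_rpow_neg_eq hp hδ.le hν hαν hc hτ0 hτ1 hδν
    exact ⟨w, hw, h1, h2, h3.symm⟩
end

section
/- Let 1 < p < ∞, δ ≥ 1, q > q*(p,δ), and define on the domain Ω_δ = {(x₁,x₂) : x₁ > 0, x₁^p ≤ x₂ ≤ (δ x₁)^p} the function B(x) = x₁^{1−q'} · ((1 − p s⁺)/(1 − p r⁺(x)))^{q'} · ((1 − (p−1) r⁺(x))/(1 − (p−1) s⁺))^{q'−1} · (1 − γ r⁺(x))/(1 − γ s⁺), where s⁺ ∈ [0,1/p] is the unique solution of (1 − p s)^{p−1}/(1 − (p−1) s)^p = δ^{−p}, r⁺(x) ∈ [0,1/p] is the unique solution of (1 − p r)^{p−1}/(1 − (p−1) r)^p = x₂/(δ x₁)^p, and γ = p + q' − 1. Then B is concave along segments in Ω_δ: for any two points x⁻, x⁺ ∈ Ω_δ such that the entire line segment joining them lies in Ω_δ, and any α⁻, α⁺ ≥ 0 with α⁻ + α⁺ = 1, one has B(α⁻ x⁻ + α⁺ x⁺) ≥ α⁻ B(x⁻) + α⁺ B(x⁺).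 -/
open MeasureTheory Set

/-- The tangent line to `u ↦ u ^ p` at `a`, evaluated at `z`. -/
noncomputable def powTangent (p z a : ℝ) : ℝ := p * z * a ^ (p - 1) - (p - 1) * a ^ p

lemma powTangent_eq {p z a : ℝ} (ha : 0 < a) :
    powTangent p z a = a ^ (p - 1) * (p * z - (p - 1) * a) := by
  have h : a ^ p = a ^ (p - 1) * a := by
    rw [← Real.rpow_add_one ha.ne']; congr 1; ring
  rw [powTangent, h]; ring

lemma hasDerivAt_powTangent (p z : ℝ) {a : ℝ} (ha : 0 < a) :
    HasDerivAt (powTangent p z) (p * (p - 1) * a ^ (p - 2) * (z - a)) a := by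
  have h1 := (Real.hasDerivAt_rpow_const (x := a) (p := p - 1) (Or.inl ha.ne')).const_mul (p * z)
  have h2 := (Real.hasDerivAt_rpow_const (x := a) (p := p) (Or.inl ha.ne')).const_mul (p - 1)
  refine (h1.sub h2).congr_deriv ?_
  have e1 : p - 1 - 1 = p - 2 := by ring
  have e2 : a ^ (p - 1) = a ^ (p - 2) * a := by
    rw [← Real.rpow_add_one ha.ne']; congr 1; ring
  rw [e1, e2]; ring

lemma continuousOn_powTangent (p z : ℝ) {S : Set ℝ} (hS : ∀ u ∈ S, 0 < u) :
    ContinuousOn (powTangent p z) S := fun u hu =>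
  (hasDerivAt_powTangent p z (hS u hu)).continuousAt.continuousWithinAt

lemma strictMonoOn_powTangent_one {p : ℝ} (hp : 1 < p) :
    StrictMonoOn (powTangent p 1) (Ioc 0 1) := by
  refine strictMonoOn_of_deriv_pos (convex_Ioc 0 1)
    (continuousOn_powTangent p 1 fun u hu => hu.1) fun u hu => ?_
  rw [interior_Ioc] at hu
  rw [(hasDerivAt_powTangent p 1 hu.1).deriv]
  have := Real.rpow_pos_of_pos hu.1 (p - 2)
  have h1 : 0 < 1 - u := sub_pos.2 hu.2
  have h2 : 0 < p - 1 := sub_pos.2 hp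
  positivity

lemma hasDerivAt_powTangent_sub (p m z k : ℝ) (hp : 1 < p) {u : ℝ} (hu : 0 < u) :
    HasDerivAt (fun u => powTangent (-m) z u
        - m * (m + 1) / (p * (p - 1)) * k * powTangent p z u)
      (m * (m + 1) * u ^ (p - 2) * ((u ^ (-m - p) - k) * (z - u))) u := by
  refine ((hasDerivAt_powTangent (-m) z hu).sub
    ((hasDerivAt_powTangent p z hu).const_mul _)).congr_deriv ?_
  have e : u ^ (-m - 2) = u ^ (-m - p) * u ^ (p - 2) := by
    rw [← Real.rpow_add hu]; congr 1; ring
  have h2 : p - 1 ≠ 0 := (sub_pos.2 hp).ne'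
  have h3 : p ≠ 0 := by positivity
  rw [e]; field_simp; ring

/-- The supporting inequality: the tangents of `u ^ (-m)` compared with those of `u ^ p`. -/
lemma powTangent_support {p m z a b : ℝ} (hp : 1 < p) (hm : 0 < m) (hb : 0 < b) (hbz : b ≤ z)
    (ha : 0 < a) (h : z < a → powTangent p z b ≤ powTangent p z a) :
    powTangent (-m) z b + m * (m + 1) / (p * (p - 1)) * a ^ (-m - p) *
      (powTangent p z a - powTangent p z b) ≤ powTangent (-m) z a := by
  have hanti : ∀ u v : ℝ, 0 < u → u ≤ v → v ^ (-m - p) ≤ u ^ (-m - p) := fun u v hu huv =>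
    Real.rpow_le_rpow_of_nonpos hu huv (by linarith)
  have hz : 0 < z := hb.trans_le hbz
  have hp1 : 0 < p - 1 := sub_pos.2 hp
  have hcont : ∀ k : ℝ, ∀ S : Set ℝ, (∀ u ∈ S, 0 < u) →
      ContinuousOn (fun u => powTangent (-m) z u
        - m * (m + 1) / (p * (p - 1)) * k * powTangent p z u) S := fun k S hS u hu =>
    (hasDerivAt_powTangent_sub p m z k hp (hS u hu)).continuousAt.continuousWithinAt
  have hpos : ∀ u : ℝ, 0 < u → 0 ≤ m * (m + 1) * u ^ (p - 2) := fun u hu => by positivity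
  rcases lt_or_ge z a with hza | haz
  · have hmono : MonotoneOn (fun u => powTangent (-m) z u
        - m * (m + 1) / (p * (p - 1)) * z ^ (-m - p) * powTangent p z u) (Ioi 0) := by
      refine monotoneOn_of_deriv_nonneg (convex_Ioi 0) (hcont _ _ fun u hu => hu)
        (fun u hu => ?_) fun u hu => ?_
      · rw [interior_Ioi] at hu
        exact (hasDerivAt_powTangent_sub p m z _ hp hu).differentiableAt.differentiableWithinAt
      · rw [interior_Ioi] at hu
        rw [(hasDerivAt_powTangent_sub p m z _ hp hu).deriv]
        refine mul_nonneg (hpos u hu) ?_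
        rcases le_total u z with h1 | h1
        · exact mul_nonneg (sub_nonneg.2 (hanti u z hu h1)) (sub_nonneg.2 h1)
        · exact mul_nonneg_of_nonpos_of_nonpos (sub_nonpos.2 (hanti z u hz h1))
            (sub_nonpos.2 h1)
    have h1 := hmono (mem_Ioi.2 hb) (mem_Ioi.2 ha) (hbz.trans hza.le)
    have h2 : m * (m + 1) / (p * (p - 1)) * a ^ (-m - p) *
        (powTangent p z a - powTangent p z b) ≤ m * (m + 1) / (p * (p - 1)) * z ^ (-m - p) *
        (powTangent p z a - powTangent p z b) :=
      mul_le_mul_of_nonneg_right (mul_le_mul_of_nonneg_left (hanti z a hz hza.le)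
        (by positivity)) (sub_nonneg.2 (h hza))
    simp only at h1
    linarith
  · rcases le_total b a with hba | hab
    · have hmono : MonotoneOn (fun u => powTangent (-m) z u
          - m * (m + 1) / (p * (p - 1)) * a ^ (-m - p) * powTangent p z u) (Ioc 0 a) := by
        refine monotoneOn_of_deriv_nonneg (convex_Ioc 0 a) (hcont _ _ fun u hu => hu.1)
          (fun u hu => ?_) fun u hu => ?_
        · rw [interior_Ioc] at hu
          exact (hasDerivAt_powTangent_sub p m z _ hp hu.1).differentiableAt.differentiableWithinAt
        · rw [interior_Ioc] at hu
          rw [(hasDerivAt_powTangent_sub p m z _ hp hu.1).deriv]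
          exact mul_nonneg (hpos u hu.1) (mul_nonneg (sub_nonneg.2 (hanti u a hu.1 hu.2.le))
            (sub_nonneg.2 (hu.2.le.trans haz)))
      have h1 := hmono ⟨hb, hba⟩ ⟨ha, le_rfl⟩ hba
      simp only at h1
      linarith
    · have hmono : AntitoneOn (fun u => powTangent (-m) z u
          - m * (m + 1) / (p * (p - 1)) * a ^ (-m - p) * powTangent p z u) (Icc a z) := by
        refine antitoneOn_of_deriv_nonpos (convex_Icc a z)
          (hcont _ _ fun u hu => ha.trans_le hu.1) (fun u hu => ?_) fun u hu => ?_
        · rw [interior_Icc] at hu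
          exact (hasDerivAt_powTangent_sub p m z _ hp
            (ha.trans hu.1)).differentiableAt.differentiableWithinAt
        · rw [interior_Icc] at hu
          rw [(hasDerivAt_powTangent_sub p m z _ hp (ha.trans hu.1)).deriv]
          exact mul_nonpos_of_nonneg_of_nonpos (hpos u (ha.trans hu.1))
            (mul_nonpos_of_nonpos_of_nonneg (sub_nonpos.2 (hanti a u ha hu.1.le))
              (sub_nonneg.2 hu.2.le))
      have h1 := hmono ⟨le_rfl, haz⟩ ⟨hab, hbz⟩ hab
      simp only at h1
      linarith

/-- A segment below the graph of `u ^ p` that starts on the tangent at `a`, to the right of `a`,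
and ends to the left of `a`, ends below that tangent. -/
lemma le_powTangent_of_segment {p a x₁ y₁ Y : ℝ} (ha : 0 < a) (hax : a ≤ x₁)
    (hya : y₁ < a)
    (hseg : ∀ θ : ℝ, 0 ≤ θ → θ ≤ 1 →
      θ * Y + (1 - θ) * powTangent p x₁ a ≤ (θ * y₁ + (1 - θ) * x₁) ^ p) :
    Y ≤ powTangent p y₁ a := by
  have hap : a ^ p = a ^ (p - 1) * a := by
    rw [← Real.rpow_add_one ha.ne']; congr 1; ring
  rcases hax.eq_or_lt with rfl | hax
  · have hd : HasDerivAt (fun θ : ℝ => (θ * y₁ + (1 - θ) * a) ^ p - θ * Y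
        - (1 - θ) * powTangent p a a) ((y₁ - a) * p * a ^ (p - 1) - Y + powTangent p a a) 0 := by
      have h1 : HasDerivAt (fun θ : ℝ => θ * y₁ + (1 - θ) * a) (y₁ - a) 0 := by
        refine (((hasDerivAt_id (0 : ℝ)).mul_const y₁).add
          (((hasDerivAt_id (0 : ℝ)).const_sub 1).mul_const a)).congr_deriv ?_
        ring
      have h2 := h1.rpow_const (p := p) (Or.inl (by simpa using ha.ne'))
      refine ((h2.sub ((hasDerivAt_id (0 : ℝ)).mul_const Y)).sub
        (((hasDerivAt_id (0 : ℝ)).const_sub 1).mul_const (powTangent p a a))).congr_deriv ?_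
      simp
    have h0 : 0 ≤ (y₁ - a) * p * a ^ (p - 1) - Y + powTangent p a a := by
      refine ge_of_tendsto hd.tendsto_slope_zero_right ?_
      filter_upwards [Ioo_mem_nhdsGT (zero_lt_one (α := ℝ))] with t ht
      have := hseg t ht.1.le ht.2.le
      refine mul_nonneg (inv_nonneg.2 ht.1.le) ?_
      simp only [zero_add, powTangent_eq ha, zero_mul, sub_zero, one_mul, hap] at this ⊢
      linarith
    rw [powTangent_eq ha] at h0 ⊢
    linarith
  · have hxy : 0 < x₁ - y₁ := by linarith
    have h := hseg ((x₁ - a) / (x₁ - y₁)) (div_nonneg (by linarith) hxy.le)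
      ((div_le_one hxy).2 (by linarith))
    have e1 : 1 - (x₁ - a) / (x₁ - y₁) = (a - y₁) / (x₁ - y₁) := by field_simp; ring
    have e2 : (x₁ - a) / (x₁ - y₁) * y₁ + (a - y₁) / (x₁ - y₁) * x₁ = a := by
      field_simp; ring
    rw [e1, e2, hap, div_mul_eq_mul_div, div_mul_eq_mul_div, ← add_div, div_le_iff₀ hxy] at h
    rw [powTangent_eq ha] at h ⊢
    have : (x₁ - a) * Y ≤ (x₁ - a) * (a ^ (p - 1) * (p * y₁ - (p - 1) * a)) := by linarith
    exact le_of_mul_le_mul_left this (by linarith)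

/-- The point of tangency, normalised by the first coordinate, attached to the parameter `r`. -/
lemma tangency_ratio {p r v : ℝ} (hp : 1 < p) (hr0 : 0 ≤ r) (hr1 : r ≤ 1 / p) (hv : 0 < v)
    (h : (1 - p * r) ^ (p - 1) / (1 - (p - 1) * r) ^ p = v) :
    0 < 1 - p * r ∧ 0 < 1 - (p - 1) * r ∧ 1 - p * r ≤ 1 - (p - 1) * r ∧
      powTangent p 1 ((1 - p * r) / (1 - (p - 1) * r)) = v := by
  have hpr : p * r ≤ 1 := by
    rw [le_div_iff₀ (by linarith)] at hr1; linarith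
  have hA : 0 < 1 - p * r := by
    rcases hpr.eq_or_lt with h1 | h1
    · rw [h1, sub_self, Real.zero_rpow (by linarith), zero_div] at h
      exact absurd h hv.ne
    · linarith
  have hle : 1 - p * r ≤ 1 - (p - 1) * r := by linarith
  have hD := hA.trans_le hle
  refine ⟨hA, hD, hle, ?_⟩
  have e : (1 - (p - 1) * r) ^ p = (1 - (p - 1) * r) ^ (p - 1) * (1 - (p - 1) * r) := by
    rw [← Real.rpow_add_one hD.ne']; congr 1; ring
  have h1 : p * 1 - (p - 1) * ((1 - p * r) / (1 - (p - 1) * r)) = 1 / (1 - (p - 1) * r) := by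
    rw [eq_div_iff hD.ne', sub_mul, mul_assoc (p - 1), div_mul_cancel₀ _ hD.ne']; ring
  rw [powTangent_eq (div_pos hA hD), Real.div_rpow hA.le hD.le, ← h, e, h1, div_mul_div_comm,
    mul_one]

lemma powTangent_mul {p z t : ℝ} (hz : 0 < z) (ht : 0 < t) :
    powTangent p z (z * t) = z ^ p * powTangent p 1 t := by
  have e : z ^ p = z ^ (p - 1) * z := by
    rw [← Real.rpow_add_one hz.ne']; congr 1; ring
  rw [powTangent_eq (mul_pos hz ht), powTangent_eq ht, Real.mul_rpow hz.le ht.le, e]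
  ring

lemma one_sub_mul_pos {p δ q qs s : ℝ} (hp : 1 < p) (hδ : 0 < δ)
    (hqs1 : 1 < qs) (hqs : ((qs / δ) ^ p - 1) / (qs - 1) = p) (hq : qs < q)
    (hs1 : 0 ≤ s) (hs2 : s ≤ 1 / p)
    (hs : (1 - p * s) ^ (p - 1) / (1 - (p - 1) * s) ^ p = δ ^ (-p)) :
    0 < 1 - (p + q / (q - 1) - 1) * s := by
  obtain ⟨hA, hD, hle, ht⟩ := tangency_ratio hp hs1 hs2 (Real.rpow_pos_of_pos hδ _) hs
  have hqs0 : 0 < qs := by linarith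
  have hval : powTangent p 1 qs⁻¹ = δ ^ (-p) := by
    rw [div_eq_iff (by linarith), Real.div_rpow hqs0.le hδ.le] at hqs
    have e : (qs⁻¹) ^ p = (qs⁻¹) ^ (p - 1) * qs⁻¹ := by
      rw [← Real.rpow_add_one (inv_ne_zero hqs0.ne')]; congr 1; ring
    have e2 : (qs⁻¹) ^ (p - 1) = (qs ^ p)⁻¹ * qs := by
      rw [← Real.inv_rpow hqs0.le, e]; field_simp
    have hδp := (Real.rpow_pos_of_pos hδ p).ne'
    have hqp := (Real.rpow_pos_of_pos hqs0 p).ne'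
    rw [powTangent_eq (inv_pos.2 hqs0), e2, Real.rpow_neg hδ.le]
    have h3 : qs ^ p = (p * (qs - 1) + 1) * δ ^ p := by
      rw [← hqs]; field_simp; ring
    rw [inv_eq_one_div (δ ^ p), eq_div_iff hδp]
    field_simp
    rw [h3]; ring
  have hts : (1 - p * s) / (1 - (p - 1) * s) = qs⁻¹ :=
    (strictMonoOn_powTangent_one hp).injOn ⟨div_pos hA hD, (div_le_one hD).2 hle⟩
      ⟨inv_pos.2 hqs0, inv_le_one_of_one_le₀ hqs1.le⟩ (ht.trans hval.symm)
  rw [div_eq_iff hD.ne', inv_mul_eq_div, eq_div_iff hqs0.ne'] at hts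
  have hq1 : 0 < q - 1 := by linarith
  have : 1 - (p + q / (q - 1) - 1) * s = (q * (1 - p * s) - (1 - (p - 1) * s)) / (q - 1) := by
    field_simp; ring
  rw [this, ← hts]
  exact div_pos (by nlinarith) hq1

/-- The Bellman function is, up to a constant, the value of a tangent line of `u ^ (-m)`. -/
lemma bellman_eq_powTangent {p m z r s : ℝ} (hz : 0 < z)
    (hA : 0 < 1 - p * r) (hD : 0 < 1 - (p - 1) * r)
    (hs1 : 0 < 1 - p * s) (hs2 : 0 < 1 - (p - 1) * s) :
    z ^ (-m) * ((1 - p * s) / (1 - p * r)) ^ (m + 1) *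
        ((1 - (p - 1) * r) / (1 - (p - 1) * s)) ^ m *
        ((1 - (p + m) * r) / (1 - (p + m) * s)) =
      (1 - p * s) ^ (m + 1) / (1 - (p - 1) * s) ^ m / (1 - (p + m) * s) *
        powTangent (-m) z (z * ((1 - p * r) / (1 - (p - 1) * r))) := by
  have ht := div_pos hA hD
  rw [powTangent_mul hz ht, powTangent_eq ht, Real.div_rpow hs1.le hA.le,
    Real.div_rpow hD.le hs2.le, show -m - 1 = -(m + 1) by ring, Real.rpow_neg ht.le,
    Real.div_rpow hA.le hD.le, Real.rpow_add_one hD.ne', inv_div]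
  have h1 := (Real.rpow_pos_of_pos hA (m + 1)).ne'
  have h2 := (Real.rpow_pos_of_pos hs2 m).ne'
  have h4 : -m * 1 - -(m + 1) * ((1 - p * r) / (1 - (p - 1) * r)) =
      (1 - (p + m) * r) / (1 - (p - 1) * r) := by
    rw [eq_div_iff hD.ne', sub_mul, mul_assoc (-(m + 1)), div_mul_cancel₀ _ hD.ne']; ring
  rw [h4]
  generalize 1 - (p - 1) * r = D at *
  field_simp

theorem statement14 (p δ q qs s : ℝ) (hp : 1 < p) (hδ : 1 ≤ δ)
    (hqs1 : 1 < qs) (hqs : ((qs / δ) ^ p - 1) / (qs - 1) = p) (hq : qs < q)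
    (hs1 : 0 ≤ s) (hs2 : s ≤ 1 / p)
    (hs : (1 - p * s) ^ (p - 1) / (1 - (p - 1) * s) ^ p = δ ^ (-p))
    -- `r x` is the unique solution `r⁺(x) ∈ [0,1/p]` of
    -- `(1-pr)^{p-1}/(1-(p-1)r)^p = x₂/(δx₁)^p` for `x ∈ Ω_δ`
    (r : ℝ × ℝ → ℝ)
    (hr : ∀ x : ℝ × ℝ, 0 < x.1 → x.1 ^ p ≤ x.2 → x.2 ≤ (δ * x.1) ^ p →
      0 ≤ r x ∧ r x ≤ 1 / p ∧
        (1 - p * r x) ^ (p - 1) / (1 - (p - 1) * r x) ^ p = x.2 / (δ * x.1) ^ p)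
    -- the Bellman function candidate `B`
    (B : ℝ × ℝ → ℝ)
    (hB : ∀ x : ℝ × ℝ, B x = x.1 ^ (1 - q / (q - 1)) *
        ((1 - p * s) / (1 - p * r x)) ^ (q / (q - 1)) *
        ((1 - (p - 1) * r x) / (1 - (p - 1) * s)) ^ (q / (q - 1) - 1) *
        ((1 - (p + q / (q - 1) - 1) * r x) / (1 - (p + q / (q - 1) - 1) * s)))
    -- two points of `Ω_δ` whose joining segment lies in `Ω_δ`
    (x₁ x₂ : ℝ × ℝ)
    (hseg : ∀ θ : ℝ, 0 ≤ θ → θ ≤ 1 →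
      0 < (θ • x₁ + (1 - θ) • x₂).1 ∧
      ((θ • x₁ + (1 - θ) • x₂).1) ^ p ≤ (θ • x₁ + (1 - θ) • x₂).2 ∧
      (θ • x₁ + (1 - θ) • x₂).2 ≤ (δ * (θ • x₁ + (1 - θ) • x₂).1) ^ p)
    (α β : ℝ) (hα : 0 ≤ α) (hβ : 0 ≤ β) (hαβ : α + β = 1) :
    α * B x₁ + β * B x₂ ≤ B (α • x₁ + β • x₂) := by
  have hδ0 : 0 < δ := by linarith
  have hγ := one_sub_mul_pos hp hδ0 hqs1 hqs hq hs1 hs2 hs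
  obtain ⟨hsA, hsD, -, -⟩ := tangency_ratio hp hs1 hs2 (Real.rpow_pos_of_pos hδ0 _) hs
  have hq1 : 0 < q - 1 := by linarith
  set m : ℝ := 1 / (q - 1) with hm_def
  have hm : 0 < m := by positivity
  have hqm : q / (q - 1) = m + 1 := by rw [hm_def]; field_simp; ring
  have hδp : 0 < δ ^ p := Real.rpow_pos_of_pos hδ0 p
  rw [hqm, show p + (m + 1) - 1 = p + m by ring] at hγ
  set C : ℝ := (1 - p * s) ^ (m + 1) / (1 - (p - 1) * s) ^ m / (1 - (p + m) * s) with hC_def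
  have hC : 0 < C := by
    have := Real.rpow_pos_of_pos hsA (m + 1)
    have := Real.rpow_pos_of_pos hsD m
    positivity
  have key : ∀ x : ℝ × ℝ, 0 < x.1 → x.1 ^ p ≤ x.2 → x.2 ≤ (δ * x.1) ^ p →
      ∃ a, 0 < a ∧ a ≤ x.1 ∧ x.2 / δ ^ p = powTangent p x.1 a ∧
        B x = C * powTangent (-m) x.1 a := by
    intro x h1 h2 h3
    obtain ⟨hr0, hr1, hr2⟩ := hr x h1 h2 h3
    have hx2 : 0 < x.2 := (Real.rpow_pos_of_pos h1 p).trans_le h2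
    obtain ⟨hA, hD, hle, ht⟩ := tangency_ratio hp hr0 hr1
      (div_pos hx2 (Real.rpow_pos_of_pos (mul_pos hδ0 h1) p)) hr2
    refine ⟨x.1 * ((1 - p * r x) / (1 - (p - 1) * r x)), mul_pos h1 (div_pos hA hD),
      mul_le_of_le_one_right h1.le ((div_le_one hD).2 hle), ?_, ?_⟩
    · rw [powTangent_mul h1 (div_pos hA hD), ht, Real.mul_rpow hδ0.le h1.le]
      have := Real.rpow_pos_of_pos h1 p
      field_simp
    · rw [hB, hqm, hC_def, ← bellman_eq_powTangent h1 hA hD hsA hsD]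
      ring_nf
  have hβα : β = 1 - α := by linarith
  subst hβα
  have hα1 : α ≤ 1 := by linarith
  have hdom₁ := hseg 1 zero_le_one le_rfl
  have hdom₂ := hseg 0 le_rfl zero_le_one
  have hdom := hseg α hα hα1
  simp only [one_smul, sub_self, zero_smul, add_zero, sub_zero, zero_add] at hdom₁ hdom₂
  obtain ⟨b₁, hb₁, hb₁', hb₁x, hb₁B⟩ := key x₁ hdom₁.1 hdom₁.2.1 hdom₁.2.2
  obtain ⟨b₂, hb₂, hb₂', hb₂x, hb₂B⟩ := key x₂ hdom₂.1 hdom₂.2.1 hdom₂.2.2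
  obtain ⟨a, ha, ha', hax, haB⟩ := key _ hdom.1 hdom.2.1 hdom.2.2
  have hbelow : ∀ τ : ℝ, 0 ≤ τ → τ ≤ 1 → τ * (x₁.2 / δ ^ p) + (1 - τ) * (x₂.2 / δ ^ p) ≤
      (τ * x₁.1 + (1 - τ) * x₂.1) ^ p := by
    intro τ h0 h1
    obtain ⟨h2, -, h3⟩ := hseg τ h0 h1
    simp only [Prod.fst_add, Prod.snd_add, Prod.smul_fst, Prod.smul_snd, smul_eq_mul] at h2 h3
    rw [Real.mul_rpow hδ0.le h2.le, ← div_le_iff₀' hδp] at h3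
    refine le_trans (le_of_eq ?_) h3
    ring
  simp only [Prod.fst_add, Prod.snd_add, Prod.smul_fst, Prod.smul_snd, smul_eq_mul] at hax ha' haB
  have hz₁ : x₁.1 < a → powTangent p x₁.1 b₁ ≤ powTangent p x₁.1 a := by
    intro hlt
    rw [← hb₁x]
    refine le_powTangent_of_segment ha ha' hlt fun θ h0 h1 => ?_
    have h := hbelow (θ + (1 - θ) * α) (add_nonneg h0 (mul_nonneg (sub_nonneg.2 h1) hα))
      (by linarith [mul_le_of_le_one_right (sub_nonneg.2 h1) hα1])
    rw [← hax]
    convert h using 1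
    · ring
    · congr 1; ring
  have hz₂ : x₂.1 < a → powTangent p x₂.1 b₂ ≤ powTangent p x₂.1 a := by
    intro hlt
    rw [← hb₂x]
    refine le_powTangent_of_segment ha ha' hlt fun θ h0 h1 => ?_
    have h := hbelow ((1 - θ) * α) (mul_nonneg (sub_nonneg.2 h1) hα)
      (mul_le_one₀ (by linarith) hα hα1)
    rw [← hax]
    convert h using 1
    · ring
    · congr 1; ring
  have hs₁ := powTangent_support hp hm hb₁ hb₁' ha hz₁
  have hs₂ := powTangent_support hp hm hb₂ hb₂' ha hz₂
  rw [← hb₁x] at hs₁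
  rw [← hb₂x] at hs₂
  rw [hb₁B, hb₂B, haB]
  have hcomb := add_le_add (mul_le_mul_of_nonneg_left hs₁ hα) (mul_le_mul_of_nonneg_left hs₂ hβ)
  have haff : ∀ e : ℝ, α * powTangent e x₁.1 a + (1 - α) * powTangent e x₂.1 a =
      powTangent e (α * x₁.1 + (1 - α) * x₂.1) a := by
    intro e; simp only [powTangent]; ring
  have hx2 : α * (x₁.2 / δ ^ p) + (1 - α) * (x₂.2 / δ ^ p) =
      α * powTangent p x₁.1 a + (1 - α) * powTangent p x₂.1 a := by
    rw [haff, ← hax]; ring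
  rw [haff (-m)] at hcomb
  have hmain : α * powTangent (-m) x₁.1 b₁ + (1 - α) * powTangent (-m) x₂.1 b₂ ≤
      powTangent (-m) (α * x₁.1 + (1 - α) * x₂.1) a := by
    linear_combination hcomb + m * (m + 1) / (p * (p - 1)) * a ^ (-m - p) * hx2
  have := mul_le_mul_of_nonneg_left hmain hC.le
  linarith
end

section
/- Let 1 < p < ∞ and fix δ > 1 and ε > δ. Then there exists a constant c ∈ (0, 1/2], depending only on p, δ and ε, with the following property: for every bounded interval J ⊂ ℝ and every weight w ∈ RH_p^δ(J), there is a splitting of J into two adjacent subintervals J⁻ (left) and J⁺ (right) with |J⁻| = α⁻|J|, |J⁺| = α⁺|J|, α⁻ + α⁺ = 1 and c ≤ α⁻, α⁺ ≤ 1 − c, such that the entire line segment joining the points x^± = (⟨w⟩_{J^±}, ⟨w^p⟩_{J^±}) is contained in Ω_ε = {(x₁,x₂) : x₁ > 0, x₁^p ≤ x₂ ≤ (ε x₁)^p}. -/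
open MeasureTheory Set

/-- The average `⟨f⟩_{(a,b)}` of a real-valued function over an interval. -/
noncomputable def avgR (f : ℝ → ℝ) (a b : ℝ) : ℝ :=
  (∫ t in Set.Ioo a b, f t) / (b - a)

/-- `w ∈ RH_p^δ([A,B])`: a nonnegative measurable weight, with `w` and `w^p`
integrable, whose `p`-reverse-Hölder ratio is at most `δ` on every subinterval. -/
def MemRHreal (p δ A B : ℝ) (w : ℝ → ℝ) : Prop :=
  Measurable w ∧ (∀ t, 0 ≤ w t) ∧
    IntegrableOn w (Set.Ioo A B) ∧ IntegrableOn (fun t => w t ^ p) (Set.Ioo A B) ∧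
    ∀ a b, A ≤ a → a < b → b ≤ B →
      avgR (fun t => w t ^ p) a b ≤ δ ^ p * (avgR w a b) ^ p

open Filter Topology

lemma avgR_eq_intervalIntegral (f : ℝ → ℝ) {a b : ℝ} (hab : a ≤ b) :
    avgR f a b = (∫ t in a..b, f t) / (b - a) := by
  rw [avgR, intervalIntegral.integral_of_le hab, integral_Ioc_eq_integral_Ioo]

lemma avgR_nonneg {f : ℝ → ℝ} (hf : ∀ t, 0 ≤ f t) {a b : ℝ} (hab : a ≤ b) : 0 ≤ avgR f a b :=
  div_nonneg (integral_nonneg hf) (sub_nonneg.2 hab)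

/-- Jensen's inequality for `x ↦ x ^ p` and averages over an interval. -/
lemma avgR_rpow_le {p a b : ℝ} (hp : 1 ≤ p) (hab : a < b) {w : ℝ → ℝ} (hw : ∀ t, 0 ≤ w t)
    (hi : IntegrableOn w (Ioo a b)) (hip : IntegrableOn (fun t => w t ^ p) (Ioo a b)) :
    avgR w a b ^ p ≤ avgR (fun t => w t ^ p) a b := by
  have hvol : volume.real (Ioo a b) = b - a := by simp [hab.le]
  have key := (convexOn_rpow hp).map_set_average_le (μ := volume) (t := Ioo a b) (f := w)
    (Real.continuous_rpow_const (by linarith)).continuousOn isClosed_Ici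
    (by simp [hab]) (by simp) (Eventually.of_forall hw) hi hip
  rw [setAverage_eq, setAverage_eq, hvol, smul_eq_mul, smul_eq_mul] at key
  simpa only [avgR, div_eq_inv_mul, Function.comp_def] using key

/-- The average over an interval is the convex combination of the averages over its two parts. -/
lemma avgR_split {f : ℝ → ℝ} {A B α : ℝ} (hAB : A < B) (hα : α ∈ Ioo (0 : ℝ) 1)
    (hf : IntegrableOn f (Ioo A B)) :
    avgR f A B = α * avgR f A (A + α * (B - A)) + (1 - α) * avgR f (A + α * (B - A)) B := by
  obtain ⟨h0, h1⟩ := hα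
  have hBA : 0 < B - A := sub_pos.2 hAB
  have hAP : A ≤ A + α * (B - A) := by nlinarith
  have hPB : A + α * (B - A) ≤ B := by nlinarith
  rw [← integrableOn_Icc_iff_integrableOn_Ioo] at hf
  have hadd := intervalIntegral.integral_add_adjacent_intervals (μ := volume)
    (f := f) (a := A) (b := A + α * (B - A)) (c := B)
    ((intervalIntegrable_iff_integrableOn_Icc_of_le hAP).2
      (hf.mono_set (Icc_subset_Icc le_rfl hPB)))
    ((intervalIntegrable_iff_integrableOn_Icc_of_le hPB).2
      (hf.mono_set (Icc_subset_Icc hAP le_rfl)))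
  rw [avgR_eq_intervalIntegral f hAB.le, avgR_eq_intervalIntegral f hAP,
    avgR_eq_intervalIntegral f hPB, ← hadd]
  have e1 : A + α * (B - A) - A = α * (B - A) := by ring
  have e2 : B - (A + α * (B - A)) = (1 - α) * (B - A) := by ring
  have h1' : 1 - α ≠ 0 := (sub_pos.2 h1).ne'
  rw [e1, e2]
  field_simp

lemma mapsTo_split_Icc {A B : ℝ} (hAB : A < B) :
    MapsTo (fun α => A + α * (B - A)) (Ioo (0 : ℝ) 1) (Icc A B) := by
  rintro α ⟨h0, h1⟩
  constructor <;> dsimp only <;> nlinarith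

lemma continuousOn_avgR_left {f : ℝ → ℝ} {A B : ℝ} (hAB : A < B)
    (hf : IntegrableOn f (Ioo A B)) :
    ContinuousOn (fun α => avgR f A (A + α * (B - A))) (Ioo 0 1) := by
  rw [← integrableOn_Icc_iff_integrableOn_Ioo, ← uIcc_of_le hAB.le] at hf
  have hF := intervalIntegral.continuousOn_primitive_interval hf
  rw [uIcc_of_le hAB.le] at hF
  have hm := mapsTo_split_Icc hAB
  refine ContinuousOn.congr (f := fun α => (∫ t in A..(A + α * (B - A)), f t) /
    (A + α * (B - A) - A)) ?_ fun α hα => avgR_eq_intervalIntegral f (hm hα).1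
  refine ContinuousOn.div (hF.comp (by fun_prop) hm) (by fun_prop) fun α hα => ?_
  have : 0 < α * (B - A) := mul_pos hα.1 (sub_pos.2 hAB)
  linarith

lemma continuousOn_avgR_right {f : ℝ → ℝ} {A B : ℝ} (hAB : A < B)
    (hf : IntegrableOn f (Ioo A B)) :
    ContinuousOn (fun α => avgR f (A + α * (B - A)) B) (Ioo 0 1) := by
  rw [← integrableOn_Icc_iff_integrableOn_Ioo, ← uIcc_of_le hAB.le] at hf
  have hF := intervalIntegral.continuousOn_primitive_interval_left hf
  rw [uIcc_of_le hAB.le] at hF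
  have hm := mapsTo_split_Icc hAB
  refine ContinuousOn.congr (f := fun α => (∫ t in (A + α * (B - A))..B, f t) /
    (B - (A + α * (B - A)))) ?_ fun α hα => avgR_eq_intervalIntegral f (hm hα).2
  refine ContinuousOn.div (hF.comp (by fun_prop) hm) (by fun_prop) fun α hα => ?_
  have : 0 < (1 - α) * (B - A) := mul_pos (sub_pos.2 hα.2) (sub_pos.2 hAB)
  linarith

/-- A connectedness argument: if each `h α` is concave on `[0, 1]` and nonpositive at `α`, and
`h c`, `h (1 - c)` are nonpositive on `[0, c]`, `[1 - c, 1]` respectively, then some `h α` is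
nonpositive on all of `[0, 1]`. -/
lemma exists_forall_nonpos_of_concaveOn {h : ℝ → ℝ → ℝ} {c : ℝ} (hc : 0 < c) (hc' : c ≤ 1 / 2)
    (hcont : ContinuousOn (fun z : ℝ × ℝ => h z.1 z.2) (Ioo 0 1 ×ˢ Icc 0 1))
    (hconc : ∀ α ∈ Ioo (0 : ℝ) 1, ConcaveOn ℝ (Icc 0 1) (h α))
    (hdiag : ∀ α ∈ Ioo (0 : ℝ) 1, h α α ≤ 0)
    (hleft : ∀ θ ∈ Icc 0 c, h c θ ≤ 0) (hright : ∀ θ ∈ Icc (1 - c) 1, h (1 - c) θ ≤ 0) :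
    ∃ α ∈ Icc c (1 - c), ∀ θ ∈ Icc (0 : ℝ) 1, h α θ ≤ 0 := by
  by_contra! hcon
  have hsub : ∀ α ∈ Icc c (1 - c), α ∈ Ioo (0 : ℝ) 1 := fun α hα =>
    ⟨by linarith [hα.1], by linarith [hα.2]⟩
  have hopen : ∀ s : ℝ, ∀ t ∈ Icc (0 : ℝ) 1, s ∈ Icc (0 : ℝ) 1 →
      IsOpen (Ioo (0 : ℝ) 1 ∩ {α | 0 < h α ((1 - t) * α + t * s)}) := by
    intro s t ht hs
    refine ContinuousOn.isOpen_inter_preimage (t := Ioi 0)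
      (f := fun α => h α ((1 - t) * α + t * s)) ?_ isOpen_Ioo isOpen_Ioi
    refine hcont.comp (f := fun α => (α, (1 - t) * α + t * s)) (by fun_prop) fun α hα => ?_
    refine ⟨hα, ?_⟩
    have := convex_Icc (0 : ℝ) 1 (Ioo_subset_Icc_self hα) hs (a := 1 - t) (b := t)
      (by linarith [ht.2]) ht.1 (by ring)
    simpa using this
  let U : ℝ → Set ℝ := fun s =>
    ⋃ t ∈ Icc (0 : ℝ) 1, Ioo (0 : ℝ) 1 ∩ {α | 0 < h α ((1 - t) * α + t * s)}
  have hU : ∀ s ∈ Icc (0 : ℝ) 1, IsOpen (U s) := fun s hs =>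
    isOpen_biUnion fun t ht => hopen s t ht hs
  have mem0 : ∀ α ∈ Ioo (0 : ℝ) 1, ∀ θ ∈ Icc 0 α, 0 < h α θ → α ∈ U 0 := by
    intro α hα θ hθ hpos
    refine mem_iUnion₂.2 ⟨1 - θ / α, ⟨?_, ?_⟩, hα, ?_⟩
    · have := (div_le_one hα.1).2 hθ.2
      linarith
    · have := div_nonneg hθ.1 hα.1.le
      linarith
    · have : (1 - (1 - θ / α)) * α + (1 - θ / α) * 0 = θ := by
        have := hα.1.ne'
        field_simp
        ring
      rwa [mem_ofPred_eq, this]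
  have mem1 : ∀ α ∈ Ioo (0 : ℝ) 1, ∀ θ ∈ Icc α 1, 0 < h α θ → α ∈ U 1 := by
    intro α hα θ hθ hpos
    have hα1 : 0 < 1 - α := sub_pos.2 hα.2
    refine mem_iUnion₂.2 ⟨(θ - α) / (1 - α), ⟨?_, ?_⟩, hα, ?_⟩
    · exact div_nonneg (sub_nonneg.2 hθ.1) hα1.le
    · rw [div_le_one hα1]
      linarith [hθ.2]
    · have : (1 - (θ - α) / (1 - α)) * α + (θ - α) / (1 - α) * 1 = θ := by
        field_simp
        ring
      rwa [mem_ofPred_eq, this]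
  have hc01 : c ∈ Icc c (1 - c) := ⟨le_rfl, by linarith⟩
  have hc10 : 1 - c ∈ Icc c (1 - c) := ⟨by linarith, le_rfl⟩
  obtain ⟨α, hα, hα0, hα1⟩ := isPreconnected_Icc (a := c) (b := 1 - c) (U 0) (U 1)
    (hU 0 (by simp)) (hU 1 (by simp))
    (fun α hα => by
      obtain ⟨θ, hθ, hpos⟩ := hcon α hα
      rcases le_total θ α with hle | hle
      · exact Or.inl (mem0 α (hsub α hα) θ ⟨hθ.1, hle⟩ hpos)
      · exact Or.inr (mem1 α (hsub α hα) θ ⟨hle, hθ.2⟩ hpos))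
    (by
      obtain ⟨θ, hθ, hpos⟩ := hcon _ hc10
      refine ⟨_, hc10, mem0 _ (hsub _ hc10) θ ⟨hθ.1, ?_⟩ hpos⟩
      by_contra! hlt
      exact hpos.not_ge (hright θ ⟨hlt.le, hθ.2⟩))
    (by
      obtain ⟨θ, hθ, hpos⟩ := hcon _ hc01
      refine ⟨_, hc01, mem1 _ (hsub _ hc01) θ ⟨?_, hθ.2⟩ hpos⟩
      by_contra! hlt
      exact hpos.not_ge (hleft θ ⟨hθ.1, hlt.le⟩))
  obtain ⟨s, hs, h01, hs0⟩ := mem_iUnion₂.1 hα0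
  obtain ⟨t, ht, -, ht0⟩ := mem_iUnion₂.1 hα1
  rw [mem_ofPred_eq] at hs0 ht0
  have hx : (1 - s) * α + s * 0 ∈ Icc (0 : ℝ) α :=
    ⟨by nlinarith [h01.1, hs.2], by nlinarith [h01.1, hs.1]⟩
  have hy : (1 - t) * α + t * 1 ∈ Icc α 1 :=
    ⟨by nlinarith [h01.2, ht.1], by nlinarith [h01.2, ht.2]⟩
  have := (hconc α h01).min_le_of_mem_Icc ⟨hx.1, hx.2.trans h01.2.le⟩
    ⟨h01.1.le.trans hy.1, hy.2⟩ ⟨hx.2, hy.1⟩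
  exact (lt_min hs0 ht0).not_ge (this.trans (hdiag α h01))

/-- If the left part of the splitting is short, the segment from the whole average to the right
average stays below the upper boundary. -/
lemma segment_le_of_short_left {p δ ε c l₁ l₂ r₁ r₂ θ : ℝ} (hp : 1 < p) (hδ : 0 < δ)
    (hε : 0 < ε) (hc : 0 < c) (hc' : c < 1) (hκ : 0 ≤ 1 - δ * c ^ (1 - 1 / p))
    (hcond : δ ^ p ≤ (1 - c) * (ε * (1 - δ * c ^ (1 - 1 / p))) ^ p)
    (hl₁ : 0 ≤ l₁) (hr₁ : 0 ≤ r₁) (hl₂ : l₁ ^ p ≤ l₂) (hr₂ : 0 ≤ r₂)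
    (hM : c * l₂ + (1 - c) * r₂ ≤ δ ^ p * (c * l₁ + (1 - c) * r₁) ^ p)
    (hθ : θ ∈ Icc 0 c) :
    θ * l₂ + (1 - θ) * r₂ ≤ (ε * (θ * l₁ + (1 - θ) * r₁)) ^ p := by
  set m := c * l₁ + (1 - c) * r₁ with hm
  set q := 1 - 1 / p with hq
  set κ := 1 - δ * c ^ q with hκdef
  have hp0 : 0 < p := by linarith
  have h1c : 0 < 1 - c := sub_pos.2 hc'
  have hm0 : 0 ≤ m := by positivity
  have hl₂0 : 0 ≤ l₂ := (Real.rpow_nonneg hl₁ p).trans hl₂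
  have hcl : c * l₁ ≤ c ^ q * (δ * m) := by
    rw [← Real.rpow_le_rpow_iff (by positivity) (by positivity) hp0, Real.mul_rpow hc.le hl₁,
      Real.mul_rpow (by positivity) (by positivity), Real.mul_rpow hδ.le hm0, ← Real.rpow_mul hc.le]
    have hqp : q * p = p - 1 := by rw [hq]; field_simp
    have hcp : c ^ p = c ^ (q * p) * c := by
      rw [hqp, Real.rpow_sub_one hc.ne']
      field_simp
    rw [hcp, mul_assoc]
    refine mul_le_mul_of_nonneg_left ?_ (by positivity)
    linarith [mul_le_mul_of_nonneg_left hl₂ hc.le, mul_nonneg h1c.le hr₂]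
  have hr : κ * m ≤ (1 - c) * r₁ := by
    rw [hκdef]; linarith
  have hx₁ : κ * m ≤ θ * l₁ + (1 - θ) * r₁ := by
    have h1 : 0 ≤ θ * l₁ := mul_nonneg hθ.1 hl₁
    have h2 : (1 - c) * r₁ ≤ (1 - θ) * r₁ := by
      gcongr
      exact hθ.2
    linarith
  have hx₂ : (1 - c) * (θ * l₂ + (1 - θ) * r₂) ≤ c * l₂ + (1 - c) * r₂ := by
    have h1 : (1 - c) * (θ * l₂) ≤ c * l₂ := by
      have : θ * l₂ ≤ c * l₂ := by gcongr; exact hθ.2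
      nlinarith [mul_nonneg hθ.1 hl₂0]
    have h2 : (1 - c) * ((1 - θ) * r₂) ≤ (1 - c) * r₂ := by
      gcongr
      nlinarith [hθ.1]
    linarith
  have hup : δ ^ p * m ^ p ≤ (1 - c) * (ε * (κ * m)) ^ p := by
    rw [← mul_assoc ε, Real.mul_rpow (by positivity) hm0, ← mul_assoc]
    gcongr
  have hmono : (ε * (κ * m)) ^ p ≤ (ε * (θ * l₁ + (1 - θ) * r₁)) ^ p := by gcongr
  refine le_trans ?_ hmono
  exact le_of_mul_le_mul_left (hx₂.trans (hM.trans hup)) h1c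

lemma exists_short_length {p δ ε : ℝ} (hp : 1 < p) (hδ : 0 < δ) (hε : δ < ε) :
    ∃ c : ℝ, 0 < c ∧ c ≤ 1 / 2 ∧ 0 ≤ 1 - δ * c ^ (1 - 1 / p) ∧
      δ ^ p ≤ (1 - c) * (ε * (1 - δ * c ^ (1 - 1 / p))) ^ p := by
  have hq : 0 < 1 - 1 / p := by
    rw [sub_pos, div_lt_one (by linarith)]
    exact hp
  have hκ : Continuous fun c : ℝ => 1 - δ * c ^ (1 - 1 / p) :=
    continuous_const.sub (continuous_const.mul (Real.continuous_rpow_const hq.le))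
  have hg : Continuous fun c : ℝ => (1 - c) * (ε * (1 - δ * c ^ (1 - 1 / p))) ^ p :=
    (by fun_prop : Continuous fun c : ℝ => 1 - c).mul
      ((continuous_const.mul hκ).rpow_const fun _ => Or.inr (by linarith))
  have e1 : ∀ᶠ c in 𝓝 (0 : ℝ), 0 < 1 - δ * c ^ (1 - 1 / p) :=
    hκ.continuousAt.eventually_const_lt (by beta_reduce; rw [Real.zero_rpow hq.ne']; simp)
  have e2 : ∀ᶠ c in 𝓝 (0 : ℝ), δ ^ p < (1 - c) * (ε * (1 - δ * c ^ (1 - 1 / p))) ^ p :=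
    hg.continuousAt.eventually_const_lt (by
      beta_reduce
      rw [Real.zero_rpow hq.ne']
      simpa using Real.rpow_lt_rpow hδ.le hε (zero_lt_one.trans hp))
  have e3 : ∀ᶠ c in 𝓝[>] (0 : ℝ), c < 1 / 2 :=
    (eventually_lt_nhds (by norm_num)).filter_mono nhdsWithin_le_nhds
  obtain ⟨c, h1, h2, h3, h4⟩ := ((e1.filter_mono nhdsWithin_le_nhds).and
    ((e2.filter_mono nhdsWithin_le_nhds).and (e3.and self_mem_nhdsWithin))).exists
  exact ⟨c, h4, h3.le, h1.le, h2.le⟩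

lemma rpow_segment_le {p a₁ a₂ b₁ b₂ θ : ℝ} (hp : 1 ≤ p) (ha : 0 ≤ a₁) (hb : 0 ≤ b₁)
    (ha₂ : a₁ ^ p ≤ a₂) (hb₂ : b₁ ^ p ≤ b₂) (h0 : 0 ≤ θ) (h1 : θ ≤ 1) :
    (θ * a₁ + (1 - θ) * b₁) ^ p ≤ θ * a₂ + (1 - θ) * b₂ := by
  have h1' := sub_nonneg.2 h1
  have := (convexOn_rpow hp).2 ha hb h0 h1' (by ring)
  simp only [smul_eq_mul] at this
  refine this.trans ?_
  gcongr

lemma concaveOn_segment {p ε a₁ a₂ b₁ b₂ : ℝ} (hp : 1 ≤ p) (hε : 0 ≤ ε) (ha : 0 ≤ a₁)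
    (hb : 0 ≤ b₁) :
    ConcaveOn ℝ (Icc (0 : ℝ) 1) fun θ =>
      θ * a₂ + (1 - θ) * b₂ - (ε * (θ * a₁ + (1 - θ) * b₁)) ^ p := by
  have hnn : ∀ θ ∈ Icc (0 : ℝ) 1, 0 ≤ ε * (θ * a₁ + (1 - θ) * b₁) := fun θ hθ =>
    mul_nonneg hε (add_nonneg (mul_nonneg hθ.1 ha) (mul_nonneg (sub_nonneg.2 hθ.2) hb))
  refine ⟨convex_Icc 0 1, fun x hx y hy s t hs ht hst => ?_⟩
  have := (convexOn_rpow hp).2 (hnn x hx) (hnn y hy) hs ht hst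
  obtain rfl : t = 1 - s := by linarith
  simp only [smul_eq_mul] at this ⊢
  have e : s * (ε * (x * a₁ + (1 - x) * b₁)) + (1 - s) * (ε * (y * a₁ + (1 - y) * b₁)) =
      ε * ((s * x + (1 - s) * y) * a₁ + (1 - (s * x + (1 - s) * y)) * b₁) := by ring
  rw [e] at this
  linarith

theorem statement15 (p δ ε : ℝ) (hp : 1 < p) (hδ : 1 < δ) (hε : δ < ε) :
    ∃ c : ℝ, 0 < c ∧ c ≤ 1 / 2 ∧
      ∀ A B : ℝ, A < B → ∀ w : ℝ → ℝ, MemRHreal p δ A B w →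
        (∀ a b, A ≤ a → a < b → b ≤ B → 0 < avgR w a b) →
        ∃ α : ℝ, c ≤ α ∧ α ≤ 1 - c ∧
          ∀ θ : ℝ, 0 ≤ θ → θ ≤ 1 →
            0 < θ * avgR w A (A + α * (B - A)) + (1 - θ) * avgR w (A + α * (B - A)) B ∧
            (θ * avgR w A (A + α * (B - A)) + (1 - θ) * avgR w (A + α * (B - A)) B) ^ p
              ≤ θ * avgR (fun t => w t ^ p) A (A + α * (B - A)) +
                (1 - θ) * avgR (fun t => w t ^ p) (A + α * (B - A)) B ∧
            θ * avgR (fun t => w t ^ p) A (A + α * (B - A)) +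
                (1 - θ) * avgR (fun t => w t ^ p) (A + α * (B - A)) B
              ≤ (ε * (θ * avgR w A (A + α * (B - A)) +
                  (1 - θ) * avgR w (A + α * (B - A)) B)) ^ p := by
  have hδ0 : 0 < δ := by linarith
  have hε0 : 0 < ε := by linarith
  obtain ⟨c, hc, hc', hκ, hcond⟩ := exists_short_length hp hδ0 hε
  refine ⟨c, hc, hc', fun A B hAB w ⟨_, hw, hi, hip, hRH⟩ hpos => ?_⟩
  have hwp : ∀ t, 0 ≤ w t ^ p := fun t => Real.rpow_nonneg (hw t) p
  let P : ℝ → ℝ := fun α => A + α * (B - A)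
  have hAP : ∀ α ∈ Ioo (0 : ℝ) 1, A < P α := fun α hα => by
    have := mul_pos hα.1 (sub_pos.2 hAB)
    simp only [P]
    linarith
  have hPB : ∀ α ∈ Ioo (0 : ℝ) 1, P α < B := fun α hα => by
    have := mul_pos (sub_pos.2 hα.2) (sub_pos.2 hAB)
    simp only [P]
    linarith
  have hL : ∀ α ∈ Ioo (0 : ℝ) 1, 0 < avgR w A (P α) := fun α hα =>
    hpos _ _ le_rfl (hAP α hα) (hPB α hα).le
  have hR : ∀ α ∈ Ioo (0 : ℝ) 1, 0 < avgR w (P α) B := fun α hα =>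
    hpos _ _ (hAP α hα).le (hPB α hα) le_rfl
  have hLp : ∀ α ∈ Ioo (0 : ℝ) 1, avgR w A (P α) ^ p ≤ avgR (fun t => w t ^ p) A (P α) :=
    fun α hα => avgR_rpow_le hp.le (hAP α hα) hw
      (hi.mono_set (Ioo_subset_Ioo le_rfl (hPB α hα).le))
      (hip.mono_set (Ioo_subset_Ioo le_rfl (hPB α hα).le))
  have hRp : ∀ α ∈ Ioo (0 : ℝ) 1, avgR w (P α) B ^ p ≤ avgR (fun t => w t ^ p) (P α) B :=
    fun α hα => avgR_rpow_le hp.le (hPB α hα) hw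
      (hi.mono_set (Ioo_subset_Ioo (hAP α hα).le le_rfl))
      (hip.mono_set (Ioo_subset_Ioo (hAP α hα).le le_rfl))
  have hwhole : ∀ α ∈ Ioo (0 : ℝ) 1,
      α * avgR (fun t => w t ^ p) A (P α) + (1 - α) * avgR (fun t => w t ^ p) (P α) B ≤
        δ ^ p * (α * avgR w A (P α) + (1 - α) * avgR w (P α) B) ^ p := fun α hα => by
    rw [← avgR_split hAB hα hi, ← avgR_split hAB hα hip]
    exact hRH A B le_rfl hAB le_rfl
  have hc1 : c ∈ Ioo (0 : ℝ) 1 := ⟨hc, by linarith⟩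
  have hc2 : 1 - c ∈ Ioo (0 : ℝ) 1 := ⟨by linarith, by linarith⟩
  obtain ⟨α, hα, hgood⟩ := exists_forall_nonpos_of_concaveOn
    (h := fun α θ => θ * avgR (fun t => w t ^ p) A (P α) +
      (1 - θ) * avgR (fun t => w t ^ p) (P α) B -
        (ε * (θ * avgR w A (P α) + (1 - θ) * avgR w (P α) B)) ^ p) hc hc'
    (by
      have lift : ∀ {f : ℝ → ℝ}, ContinuousOn f (Ioo 0 1) →
          ContinuousOn (fun z : ℝ × ℝ => f z.1) (Ioo 0 1 ×ˢ Icc 0 1) := fun hf =>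
        hf.comp continuous_fst.continuousOn fun z hz => hz.1
      have c1 := lift (continuousOn_avgR_left hAB hi)
      have c2 := lift (continuousOn_avgR_left hAB hip)
      have c3 := lift (continuousOn_avgR_right hAB hi)
      have c4 := lift (continuousOn_avgR_right hAB hip)
      have hθ : ContinuousOn (fun z : ℝ × ℝ => z.2) (Ioo 0 1 ×ˢ Icc 0 1) := by fun_prop
      have hθ' : ContinuousOn (fun z : ℝ × ℝ => 1 - z.2) (Ioo 0 1 ×ˢ Icc 0 1) := by fun_prop
      exact ((hθ.mul c2).add (hθ'.mul c4)).sub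
        ((continuousOn_const.mul ((hθ.mul c1).add (hθ'.mul c3))).rpow_const
          fun _ _ => Or.inr (by linarith)))
    (fun α hα => concaveOn_segment hp.le hε0.le (hL α hα).le (hR α hα).le)
    (fun α hα => by
      have hm : 0 ≤ α * avgR w A (P α) + (1 - α) * avgR w (P α) B :=
        add_nonneg (mul_nonneg hα.1.le (hL α hα).le)
          (mul_nonneg (sub_nonneg.2 hα.2.le) (hR α hα).le)
      rw [sub_nonpos, Real.mul_rpow hε0.le hm]
      refine (hwhole α hα).trans ?_
      gcongr)
    (fun θ hθ => sub_nonpos.2 <| segment_le_of_short_left hp hδ0 hε0 hc hc1.2 hκ hcond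
      (hL c hc1).le (hR c hc1).le (hLp c hc1) (avgR_nonneg hwp (hPB c hc1).le)
      (hwhole c hc1) hθ)
    (fun θ hθ => sub_nonpos.2 <| by
      have hw' := hwhole _ hc2
      rw [sub_sub_cancel, add_comm, add_comm ((1 - c) * avgR w A _)] at hw'
      have := segment_le_of_short_left (θ := 1 - θ) hp hδ0 hε0 hc hc1.2 hκ hcond
        (hR _ hc2).le (hL _ hc2).le (hRp _ hc2) (avgR_nonneg hwp (hAP _ hc2).le) hw'
        ⟨by linarith [hθ.2], by linarith [hθ.1]⟩
      rwa [sub_sub_cancel, add_comm, add_comm ((1 - θ) * avgR w _ B)] at this)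
  refine ⟨α, hα.1, hα.2, fun θ h0 h1 => ?_⟩
  have hα' : α ∈ Ioo (0 : ℝ) 1 := ⟨hc.trans_le hα.1, by linarith [hα.2]⟩
  refine ⟨?_, rpow_segment_le hp.le (hL α hα').le (hR α hα').le (hLp α hα') (hRp α hα') h0 h1,
    sub_nonpos.1 (hgood θ ⟨h0, h1⟩)⟩
  have := convex_Ioi (0 : ℝ) (hL α hα') (hR α hα') h0 (sub_nonneg.2 h1) (by ring)
  simpa using this
end

section
/- Fix n > 1 and 1 < p < ∞, let Q ⊂ ℝ^n be an axis-parallel cube divided into 2^n congruent axis-parallel subcubes Q₁, …, Q_{2^n}, and let w be a weight on Q satisfying ⟨w^p⟩_K ≤ δ^p ⟨w⟩_K^p for every axis-parallel subcube K ⊂ Q. If 1 ≤ δ < (2^n/(2^n − 1))^{1/p'} and y ≥ 1 satisfies (2 + 2^n(δ^{−p'} − 1))^{p−1} = (1 + y)^p/(1 + y^p), then for all indices i, j one has 1/y ≤ ⟨w⟩_{Q_i}/⟨w⟩_{Q_j} ≤ y. -/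
open MeasureTheory Set ENNReal

/-- The average of an `ℝ≥0∞`-valued function over the open axis-parallel cube
with corner `k` and side length `ℓ`. -/
noncomputable def cubeAvg {n : ℕ} (w : (Fin n → ℝ) → ℝ≥0∞) (k : Fin n → ℝ) (ℓ : ℝ) : ℝ≥0∞ :=
  (∫⁻ x in Set.pi Set.univ fun i => Set.Ioo (k i) (k i + ℓ), w x) /
    ENNReal.ofReal (ℓ ^ n)

/-- The cube with corner `k` and side `ℓ` is an axis-parallel subcube of the cube
with corner `c` and side `L`. -/
def SubCube {n : ℕ} (c : Fin n → ℝ) (L : ℝ) (k : Fin n → ℝ) (ℓ : ℝ) : Prop :=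
  0 < ℓ ∧ ∀ i, c i ≤ k i ∧ k i + ℓ ≤ c i + L

/-- The corner of the dyadic child of the cube with corner `c` and side `L`
indexed by `e : Fin n → Bool`. -/
noncomputable def childCorner {n : ℕ} (c : Fin n → ℝ) (L : ℝ) (e : Fin n → Bool) :
    Fin n → ℝ :=
  fun i => c i + if e i then L / 2 else 0

theorem Real.strictMonoOn_one_add_rpow_div {p : ℝ} (hp : 1 < p) :
    StrictMonoOn (fun s : ℝ => (1 + s) ^ p / (1 + s ^ p)) (Set.Icc 0 1) := by
  have hpos : ∀ s : ℝ, 0 ≤ s → 0 < 1 + s ^ p := fun s hs => by positivity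
  apply strictMonoOn_of_deriv_pos (convex_Icc 0 1)
  · refine ContinuousOn.div ?_ ?_ fun s hs => (hpos s hs.1).ne'
    · exact ((continuous_const.add continuous_id).rpow_const
        fun _ => Or.inr (by linarith)).continuousOn
    · exact (continuous_const.add (continuous_id.rpow_const
        fun _ => Or.inr (by linarith))).continuousOn
  · intro s hs
    rw [interior_Icc] at hs
    obtain ⟨h0, h1⟩ := hs
    have hd1 : HasDerivAt (fun s : ℝ => (1 + s) ^ p) (1 * p * (1 + s) ^ (p - 1)) s :=
      ((hasDerivAt_id s).const_add 1).rpow_const (Or.inl (by simp only [id]; positivity))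
    have hd2 : HasDerivAt (fun s : ℝ => 1 + s ^ p) (p * s ^ (p - 1)) s :=
      (Real.hasDerivAt_rpow_const (Or.inl h0.ne')).const_add 1
    rw [(hd1.fun_div hd2 (hpos s h0.le).ne').deriv]
    apply div_pos _ (pow_pos (hpos s h0.le) 2)
    have e1 : (1 + s) ^ p = (1 + s) ^ (p - 1) * (1 + s) := by
      rw [Real.rpow_sub_one (by positivity)]; field_simp
    have e2 : s ^ p = s ^ (p - 1) * s := by
      rw [Real.rpow_sub_one h0.ne']; field_simp
    have hs1 : s ^ (p - 1) < 1 := Real.rpow_lt_one h0.le h1 (by linarith)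
    have : 0 < p * (1 + s) ^ (p - 1) * (1 - s ^ (p - 1)) := by
      have : 0 < 1 - s ^ (p - 1) := by linarith
      positivity
    rw [e1, e2]
    linarith

/-- Hölder's inequality for `∑ k, a k` in which two of the terms are merged into one. -/
theorem Real.rpow_sum_le_merge {ι : Type*} [Fintype ι] [DecidableEq ι] {p : ℝ} (hp : 1 < p)
    {a : ι → ℝ} (ha : ∀ k, 0 ≤ a k) {i j : ι} (hij : i ≠ j) (hi : 0 < a i) :
    (∑ k, a k) ^ p ≤
      (((a i + a j) ^ p / (a i ^ p + a j ^ p)) ^ (p - 1)⁻¹ + Fintype.card ι - 2) ^ (p - 1) *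
        ∑ k, a k ^ p := by
  have hj := ha j
  have hD : 0 < a i ^ p + a j ^ p := by positivity
  set R := ((a i + a j) ^ p / (a i ^ p + a j ^ p)) ^ (p - 1)⁻¹ with hR
  have hRpos : 0 < R := by positivity
  have hRp : R ^ (p - 1) = (a i + a j) ^ p / (a i ^ p + a j ^ p) :=
    Real.rpow_inv_rpow (by positivity) (by linarith)
  have hsplit : ∀ g : ι → ℝ, ∑ k, g k = g j + (g i + ∑ k ∈ (Finset.univ.erase j).erase i, g k) := by
    intro g
    rw [Finset.add_sum_erase _ _ (by simp [hij]), Finset.add_sum_erase _ _ (by simp)]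
  have hmerge : ∀ g : ι → ℝ, ∑ k ∈ Finset.univ.erase j, g k =
      g i + ∑ k ∈ (Finset.univ.erase j).erase i, g k := fun g => by
    rw [Finset.add_sum_erase _ _ (by simp [hij])]
  have hrest : ∀ (g : ι → ℝ → ℝ → ℝ),
      ∑ k ∈ (Finset.univ.erase j).erase i,
        g k (if k = i then R else 1) (if k = i then (a i + a j) / R else a k) =
      ∑ k ∈ (Finset.univ.erase j).erase i, g k 1 (a k) := by
    intro g
    refine Finset.sum_congr rfl fun k hk => ?_
    simp [Finset.ne_of_mem_erase hk]
  have key := Real.inner_le_weight_mul_Lp_of_nonneg (Finset.univ.erase j) hp.le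
    (fun k => if k = i then R else 1) (fun k => if k = i then (a i + a j) / R else a k)
    (fun k => by split_ifs <;> positivity)
    (fun k => by split_ifs; exacts [by positivity, ha k])
  rw [hmerge, hmerge, hmerge, hrest fun _ x y => x * y, hrest fun _ x _ => x,
    hrest fun _ x y => x * y ^ p] at key
  have hcard : R + ∑ k ∈ (Finset.univ.erase j).erase i, (1 : ℝ) = R + Fintype.card ι - 2 := by
    have := hsplit fun _ => 1
    simp only [Finset.sum_const, Finset.card_univ, nsmul_eq_mul, mul_one] at this ⊢
    linarith
  have hTi : R * ((a i + a j) / R) ^ p = a i ^ p + a j ^ p := by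
    have : R ^ p = R ^ (p - 1) * R := by rw [Real.rpow_sub_one hRpos.ne']; field_simp
    rw [Real.div_rpow (by positivity) hRpos.le, this, hRp]
    have : (a i + a j) ^ p ≠ 0 := by positivity
    field_simp
  have hT : a i ^ p + a j ^ p + ∑ k ∈ (Finset.univ.erase j).erase i, 1 * a k ^ p
      = ∑ k, a k ^ p := by
    rw [hsplit]; simp only [one_mul]; ring
  have hS : R * ((a i + a j) / R) + ∑ k ∈ (Finset.univ.erase j).erase i, 1 * a k
      = ∑ k, a k := by
    rw [hsplit a, mul_div_cancel₀ _ hRpos.ne']; simp only [one_mul]; ring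
  simp only [if_true] at key
  rw [hcard, hTi, hT, hS] at key
  have hW : 0 ≤ R + Fintype.card ι - 2 := by
    rw [← hcard]; exact add_nonneg hRpos.le (Finset.sum_nonneg fun _ _ => zero_le_one)
  have hTn : 0 ≤ ∑ k, a k ^ p := Finset.sum_nonneg fun k _ => Real.rpow_nonneg (ha k) p
  refine (Real.rpow_le_rpow (Finset.sum_nonneg fun k _ => ha k) key (by linarith)).trans_eq ?_
  rw [Real.mul_rpow (by positivity) (by positivity), ← Real.rpow_mul hW, ← Real.rpow_mul hTn,
    sub_mul, inv_mul_cancel₀ (by linarith), Real.rpow_one, one_mul]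

/-- If the `p`-means of finitely many nonnegative reals satisfy a reverse Hölder inequality with
constant `δ`, then the ratio of any two of them is at most `y`. -/
theorem Real.le_mul_of_sum_rpow_le {ι : Type*} [Fintype ι] [DecidableEq ι] {p δ y : ℝ}
    (hp : 1 < p) (hδ : 0 < δ) (hy1 : 1 ≤ y)
    (hB : 0 ≤ 2 + Fintype.card ι * (δ ^ (-(p / (p - 1))) - 1))
    (hy : (2 + Fintype.card ι * (δ ^ (-(p / (p - 1))) - 1)) ^ (p - 1) =
      (1 + y) ^ p / (1 + y ^ p))
    {a : ι → ℝ} (ha : ∀ k, 0 ≤ a k)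
    (h : (∑ k, a k ^ p) / Fintype.card ι ≤ δ ^ p * ((∑ k, a k) / Fintype.card ι) ^ p)
    (i j : ι) : a i ≤ y * a j := by
  have hj := ha j
  rcases eq_or_ne i j with rfl | hij
  · nlinarith
  by_contra! hlt
  have hi : 0 < a i := lt_of_le_of_lt (by positivity) hlt
  have hN : (0 : ℝ) < Fintype.card ι := by
    exact_mod_cast Fintype.card_pos_iff.2 ⟨i⟩
  have hmono : (a i + a j) ^ p / (a i ^ p + a j ^ p) < (1 + y) ^ p / (1 + y ^ p) := by
    have hy0 : 0 < y := by linarith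
    have hs : a j / a i < y⁻¹ := by
      rw [div_lt_iff₀ hi, inv_mul_eq_div, lt_div_iff₀ hy0]; linarith
    have := Real.strictMonoOn_one_add_rpow_div hp
      ⟨by positivity, (hs.trans_le (inv_le_one_of_one_le₀ hy1)).le⟩
      ⟨by positivity, inv_le_one_of_one_le₀ hy1⟩ hs
    simp only at this
    have e1 : (1 + a j / a i) ^ p / (1 + (a j / a i) ^ p) =
        (a i + a j) ^ p / (a i ^ p + a j ^ p) := by
      rw [one_add_div hi.ne', Real.div_rpow (by positivity) hi.le, Real.div_rpow hj hi.le]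
      have : a i ^ p ≠ 0 := by positivity
      field_simp
    have e2 : (1 + y⁻¹) ^ p / (1 + y⁻¹ ^ p) = (1 + y) ^ p / (1 + y ^ p) := by
      rw [show 1 + y⁻¹ = (1 + y) / y by field_simp; ring, Real.div_rpow (by positivity) hy0.le,
        Real.inv_rpow hy0.le]
      field_simp
      ring
    rwa [e1, e2] at this
  rw [← hy] at hmono
  have hmerge := Real.rpow_sum_le_merge hp ha hij hi
  set N : ℝ := (Fintype.card ι : ℝ)
  set T := ∑ k, a k ^ p
  set S := ∑ k, a k
  set R := ((a i + a j) ^ p / (a i ^ p + a j ^ p)) ^ (p - 1)⁻¹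
  have hp1 : 0 < p - 1 := by linarith
  have hRB : R < 2 + N * (δ ^ (-(p / (p - 1))) - 1) := by
    have := Real.rpow_lt_rpow (by positivity) hmono (inv_pos.2 hp1)
    rwa [Real.rpow_rpow_inv hB hp1.ne'] at this
  have hT : 0 < T := Finset.sum_pos' (fun k _ => Real.rpow_nonneg (ha k) p)
    ⟨i, Finset.mem_univ _, by positivity⟩
  have hS : 0 < S := Finset.sum_pos' (fun k _ => ha k) ⟨i, Finset.mem_univ _, hi⟩
  have hR0 : 0 ≤ R + N - 2 := by
    have h2 : ((2 : ℕ) : ℝ) ≤ Fintype.card ι :=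
      Nat.cast_le.2 (Fintype.one_lt_card_iff.2 ⟨i, j, hij⟩)
    have h2N : (2 : ℝ) ≤ N := h2
    have : 0 ≤ R := by positivity
    linarith
  have hW : (R + N - 2) ^ (p - 1) < (N * δ ^ (-(p / (p - 1)))) ^ (p - 1) :=
    Real.rpow_lt_rpow hR0 (by linarith) hp1
  have hW' : (N * δ ^ (-(p / (p - 1)))) ^ (p - 1) = N ^ (p - 1) / δ ^ p := by
    rw [Real.mul_rpow hN.le (by positivity), ← Real.rpow_mul hδ.le, neg_mul,
      div_mul_cancel₀ _ hp1.ne', Real.rpow_neg hδ.le]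
    rfl
  rw [hW'] at hW
  have h1 : S ^ p < N ^ (p - 1) / δ ^ p * T :=
    hmerge.trans_lt (mul_lt_mul_of_pos_right hW hT)
  rw [Real.div_rpow hS.le hN.le] at h
  have e : N ^ p = N ^ (p - 1) * N := by rw [Real.rpow_sub_one hN.ne']; field_simp
  rw [e] at h
  have hc : 0 < N ^ (p - 1) := by positivity
  have hd : 0 < δ ^ p := by positivity
  have h2 : T * N ^ (p - 1) ≤ δ ^ p * S ^ p := by
    have := mul_le_mul_of_nonneg_right h (by positivity : 0 ≤ N ^ (p - 1) * N)
    field_simp at this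
    linarith
  have h3 : δ ^ p * S ^ p < N ^ (p - 1) * T := by
    have := mul_lt_mul_of_pos_left h1 hd
    field_simp at this
    linarith
  linarith

theorem iUnion_childCorner_eq {n : ℕ} (c : Fin n → ℝ) {L : ℝ} (hL : 0 < L) :
    (⋃ e : Fin n → Bool, Set.pi Set.univ fun i =>
      Set.Ico (childCorner c L e i) (childCorner c L e i + L / 2)) =
    Set.pi Set.univ fun i => Set.Ico (c i) (c i + L) := by
  ext x
  simp only [mem_iUnion, mem_univ_pi, mem_Ico, childCorner]
  constructor
  · rintro ⟨e, he⟩ i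
    have := he i
    cases h : e i <;> simp only [h, if_true, if_false, Bool.false_eq_true] at this <;>
      constructor <;> linarith
  · intro hx
    refine ⟨fun i => decide (c i + L / 2 ≤ x i), fun i => ?_⟩
    have := hx i
    beta_reduce
    by_cases h : c i + L / 2 ≤ x i
    · rw [decide_eq_true h, if_pos rfl]
      constructor <;> linarith
    · rw [decide_eq_false h, if_neg Bool.false_ne_true]
      constructor <;> linarith

theorem pairwise_disjoint_childCorner {n : ℕ} (c : Fin n → ℝ) (L : ℝ) :
    Pairwise (Function.onFun Disjoint fun e : Fin n → Bool => Set.pi Set.univ fun i =>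
      Set.Ico (childCorner c L e i) (childCorner c L e i + L / 2)) := by
  intro e e' hne
  obtain ⟨i, hi⟩ := Function.ne_iff.1 hne
  refine Set.disjoint_left.2 fun x hx hx' => ?_
  have h := hx i (mem_univ i)
  have h' := hx' i (mem_univ i)
  simp only [childCorner, mem_Ico] at h h'
  cases he : e i <;> cases he' : e' i <;> simp [he, he'] at hi h h' <;> linarith

theorem setLIntegral_cube_eq_sum_child {n : ℕ} (c : Fin n → ℝ) {L : ℝ} (hL : 0 < L)
    (f : (Fin n → ℝ) → ℝ≥0∞) :
    (∫⁻ x in Set.pi Set.univ fun i => Set.Ioo (c i) (c i + L), f x) =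
      ∑ e, ∫⁻ x in Set.pi Set.univ fun i =>
        Set.Ioo (childCorner c L e i) (childCorner c L e i + L / 2), f x := by
  have key : ∀ (k : Fin n → ℝ) (l : ℝ),
      (∫⁻ x in Set.pi Set.univ fun i => Set.Ioo (k i) (k i + l), f x) =
        ∫⁻ x in Set.pi Set.univ fun i => Set.Ico (k i) (k i + l), f x := fun k l =>
    setLIntegral_congr (Measure.univ_pi_Ioo_ae_eq_Icc.trans Measure.univ_pi_Ico_ae_eq_Icc.symm)
  simp_rw [key]
  rw [← iUnion_childCorner_eq c hL, lintegral_iUnion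
    (fun e => MeasurableSet.univ_pi fun i => measurableSet_Ico)
    (pairwise_disjoint_childCorner c L), tsum_fintype]

theorem cubeAvg_eq_sum_child {n : ℕ} (c : Fin n → ℝ) {L : ℝ} (hL : 0 < L)
    (f : (Fin n → ℝ) → ℝ≥0∞) :
    cubeAvg f c L = (∑ e, cubeAvg f (childCorner c L e) (L / 2)) / 2 ^ n := by
  have h : ENNReal.ofReal (L ^ n) = ENNReal.ofReal ((L / 2) ^ n) * 2 ^ n := by
    rw [div_pow, ← ENNReal.ofReal_ofNat 2, ← ENNReal.ofReal_pow (by norm_num),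
      ← ENNReal.ofReal_mul (by positivity)]
    congr 1
    field_simp
  simp_rw [cubeAvg, setLIntegral_cube_eq_sum_child c hL, h, div_eq_mul_inv]
  rw [← Finset.sum_mul, ENNReal.mul_inv (by simp) (by simp), mul_assoc]

theorem cubeAvg_rpow_le {n : ℕ} {p : ℝ} (hp : 1 < p) {w : (Fin n → ℝ) → ℝ≥0∞}
    (hw : Measurable w) (k : Fin n → ℝ) {l : ℝ} (hl : 0 < l) :
    cubeAvg w k l ^ p ≤ cubeAvg (fun x => w x ^ p) k l := by
  have hp0 : 0 < p := by linarith
  have hq := Real.HolderConjugate.conjExponent hp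
  have hvol : volume (Set.pi Set.univ fun i => Set.Ioo (k i) (k i + l)) =
      ENNReal.ofReal (l ^ n) := by
    rw [Real.volume_pi_Ioo]
    simp [ENNReal.ofReal_pow hl.le]
  have key := ENNReal.lintegral_mul_le_Lp_mul_Lq
    (volume.restrict (Set.pi Set.univ fun i => Set.Ioo (k i) (k i + l))) hq
    hw.aemeasurable (aemeasurable_const (b := (1 : ℝ≥0∞)))
  simp only [Pi.mul_apply, mul_one, ENNReal.one_rpow, lintegral_const, one_mul,
    Measure.restrict_apply_univ, hvol] at key
  unfold cubeAvg
  set V := ENNReal.ofReal (l ^ n)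
  have hV0 : V ≠ 0 := by simp [V, hl]
  have hVt : V ≠ ⊤ := by simp [V]
  have key2 := ENNReal.rpow_le_rpow key hp0.le
  rw [ENNReal.mul_rpow_of_nonneg _ _ hp0.le, ← ENNReal.rpow_mul, ← ENNReal.rpow_mul,
    one_div_mul_cancel hp0.ne', ENNReal.rpow_one] at key2
  have he : 1 / p.conjExponent * p = p - 1 := by
    rw [Real.conjExponent]; field_simp
  rw [he] at key2
  rw [ENNReal.div_rpow_of_nonneg _ _ hp0.le]
  refine (ENNReal.div_le_div_right key2 _).trans_eq ?_
  rw [div_eq_mul_inv, div_eq_mul_inv, mul_assoc, ← ENNReal.rpow_neg, ← ENNReal.rpow_add _ _ hV0 hVt]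
  rw [show p - 1 + -p = -1 by ring, ENNReal.rpow_neg_one]

theorem statement17 (n : ℕ) (hn : 1 < n) (p δ y : ℝ) (hp : 1 < p)
    (c : Fin n → ℝ) (L : ℝ) (hL : 0 < L)
    (hδ1 : 1 ≤ δ) (hδ2 : δ < ((2 ^ n : ℝ) / (2 ^ n - 1)) ^ ((p - 1) / p))
    (hy1 : 1 ≤ y)
    (hy : (2 + 2 ^ n * (δ ^ (-(p / (p - 1))) - 1)) ^ (p - 1) = (1 + y) ^ p / (1 + y ^ p))
    (w : (Fin n → ℝ) → ℝ≥0∞) (hwm : Measurable w)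
    (hint : (∫⁻ x in Set.pi Set.univ fun i => Set.Ioo (c i) (c i + L), w x) ≠ ⊤)
    (hRH : ∀ k ℓ, SubCube c L k ℓ →
      cubeAvg (fun x => w x ^ p) k ℓ ≤ ENNReal.ofReal δ ^ p * (cubeAvg w k ℓ) ^ p) :
    ∀ e e' : Fin n → Bool,
      cubeAvg w (childCorner c L e) (L / 2)
        ≤ ENNReal.ofReal y * cubeAvg w (childCorner c L e') (L / 2) := by
  have hp0 : 0 < p := by linarith
  have hp1 : 0 < p - 1 := by linarith
  have hδ0 : 0 < δ := by linarith
  set a : (Fin n → Bool) → ℝ≥0∞ := fun e => cubeAvg w (childCorner c L e) (L / 2)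
  have hfin : ∀ e, a e ≠ ⊤ := by
    rw [setLIntegral_cube_eq_sum_child c hL] at hint
    intro e
    exact ENNReal.div_ne_top ((ENNReal.sum_ne_top.1 hint) e (Finset.mem_univ e)) (by simp [hL])
  have hmean : (∑ e, a e ^ p) / 2 ^ n ≤ ENNReal.ofReal δ ^ p * ((∑ e, a e) / 2 ^ n) ^ p := by
    have h := hRH c L ⟨hL, fun i => ⟨le_rfl, le_rfl⟩⟩
    rw [cubeAvg_eq_sum_child c hL, cubeAvg_eq_sum_child c hL] at h
    exact (ENNReal.div_le_div_right (Finset.sum_le_sum fun e _ =>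
      cubeAvg_rpow_le hp hwm _ (half_pos hL)) _).trans h
  have hreal : (∑ e, (a e).toReal ^ p) / 2 ^ n ≤ δ ^ p * ((∑ e, (a e).toReal) / 2 ^ n) ^ p := by
    have hrhs : ENNReal.ofReal δ ^ p * ((∑ e, a e) / 2 ^ n) ^ p ≠ ⊤ :=
      ENNReal.mul_ne_top (ENNReal.rpow_ne_top_of_nonneg hp0.le ENNReal.ofReal_ne_top)
        (ENNReal.rpow_ne_top_of_nonneg hp0.le
          (ENNReal.div_ne_top (ENNReal.sum_ne_top.2 fun e _ => hfin e) (by simp)))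
    have h := ENNReal.toReal_mono hrhs hmean
    rw [ENNReal.toReal_mul, ENNReal.toReal_div, ← ENNReal.toReal_rpow, ← ENNReal.toReal_rpow,
      ENNReal.toReal_div, ENNReal.toReal_sum fun e _ => hfin e,
      ENNReal.toReal_sum fun e _ => ENNReal.rpow_ne_top_of_nonneg hp0.le (hfin e)] at h
    simpa [ENNReal.toReal_ofReal hδ0.le, ← ENNReal.toReal_rpow] using h
  have hcard : (Fintype.card (Fin n → Bool) : ℝ) = 2 ^ n := by simp
  have hB : 0 ≤ 2 + 2 ^ n * (δ ^ (-(p / (p - 1))) - 1) := by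
    have hN : (1 : ℝ) < 2 ^ n := one_lt_pow₀ (by norm_num) (by omega)
    have hN1 : (0 : ℝ) < 2 ^ n - 1 := by linarith
    have h := Real.rpow_le_rpow hδ0.le hδ2.le (by positivity : 0 ≤ p / (p - 1))
    rw [← Real.rpow_mul (by positivity), div_mul_div_cancel₀ hp0.ne', div_self hp1.ne',
      Real.rpow_one] at h
    have h' := inv_anti₀ (by positivity) h
    rw [← Real.rpow_neg hδ0.le, inv_div, div_le_iff₀ (by positivity)] at h'
    linarith
  intro e e'
  have h := Real.le_mul_of_sum_rpow_le hp hδ0 hy1 (by rwa [hcard]) (by rwa [hcard])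
    (a := fun e => (a e).toReal) (fun _ => ENNReal.toReal_nonneg) (by rwa [hcard]) e e'
  have h' := ENNReal.ofReal_le_ofReal h
  rwa [ENNReal.ofReal_mul (by linarith), ENNReal.ofReal_toReal (hfin e),
    ENNReal.ofReal_toReal (hfin e')] at h'
end
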